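/- Let r and s be multiplicatively independent positive integers. No irrational real number has simultaneously a Sturmian r-ary expansion and a Sturmian s-ary expansion. -/

import Mathlib

/-- Number of distinct factors of length `n` of the infinite word `x`. -/
noncomputable def wordComplexity {A : Type*} (x : ℕ → A) (n : ℕ) : ℕ :=
  Set.ncard {w : Fin n → A | ∃ j : ℕ, ∀ i : Fin n, w i = x (j + i)}

/-- The `(k+1)`-st digit of the `b`-ary expansion of the fractional part of `ξ`. -/
noncomputable def bdigit (b : ℕ) (ξ : ℝ) (k : ℕ) : ℕ :=
  (⌊(b : ℝ) * Int.fract ((b : ℝ) ^ k * Int.fract ξ)⌋).toNat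

/-- Positive integers `r` and `s` are multiplicatively independent. -/
def MultIndep (r s : ℕ) : Prop := ∀ m n : ℕ, r ^ m = s ^ n → m = 0 ∧ n = 0

/-- Low complexity gives an early repetition. -/
lemma exists_rep (x : ℕ → ℕ) (n : ℕ) (h : wordComplexity x n = n + 1) :
    ∃ u v : ℕ, 1 ≤ v ∧ u + v ≤ n + 1 ∧ ∀ i < n, x (u + i) = x (u + v + i) := by
  set S : Set (Fin n → ℕ) := {w : Fin n → ℕ | ∃ j : ℕ, ∀ i : Fin n, w i = x (j + i)} with hS
  have hc : S.ncard = n + 1 := h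
  have hfin : S.Finite := Set.finite_of_ncard_ne_zero (by omega)
  let f : ℕ → (Fin n → ℕ) := fun j i => x (j + i)
  have hmap : ∀ j ∈ Finset.range (n + 2), f j ∈ hfin.toFinset := by
    intro j _
    rw [Set.Finite.mem_toFinset]
    exact ⟨j, fun i => rfl⟩
  have hcard : hfin.toFinset.card < (Finset.range (n + 2)).card := by
    rw [Finset.card_range, ← Set.ncard_eq_toFinset_card S hfin, hc]; omega
  obtain ⟨a, ha, b, hb, hab, hf⟩ := Finset.exists_ne_map_eq_of_card_lt_of_maps_to hcard hmap
  rw [Finset.mem_range] at ha hb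
  have key : ∀ i < n, x (a + i) = x (b + i) := fun i hi => congrFun hf ⟨i, hi⟩
  rcases lt_or_gt_of_ne hab with hlt | hlt
  · refine ⟨a, b - a, by omega, by omega, fun i hi => ?_⟩
    rw [show a + (b - a) = b by omega]; exact key i hi
  · refine ⟨b, a - b, by omega, by omega, fun i hi => ?_⟩
    rw [show b + (a - b) = a by omega]; exact (key i hi).symm

lemma period_mul (x : ℕ → ℕ) (g L : ℕ) (h : ∀ i, i + g < L → x i = x (i + g)) (c : ℕ) :
    ∀ i, i + c * g < L → x i = x (i + c * g) := by
  induction c with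
  | zero => intro i _; simp
  | succ c ih =>
    intro i hi
    have e : i + (c + 1) * g = i + c * g + g := by ring
    rw [e] at hi ⊢
    rw [ih i (by omega), h _ hi]

/-- Fine and Wilf. -/
lemma fine_wilf (k : ℕ) : ∀ (x : ℕ → ℕ) (p q L : ℕ), p + q ≤ k → 1 ≤ p → 1 ≤ q →
    p + q ≤ L + Nat.gcd p q →
    (∀ i, i + p < L → x i = x (i + p)) → (∀ i, i + q < L → x i = x (i + q)) →
    ∀ i, i + Nat.gcd p q < L → x i = x (i + Nat.gcd p q) := by
  induction k with
  | zero => intro x p q L h hp; omega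
  | succ k ih =>
    have main : ∀ (x : ℕ → ℕ) (p q L : ℕ), p < q → p + q ≤ k + 1 → 1 ≤ p → 1 ≤ q →
        p + q ≤ L + Nat.gcd p q →
        (∀ i, i + p < L → x i = x (i + p)) → (∀ i, i + q < L → x i = x (i + q)) →
        ∀ i, i + Nat.gcd p q < L → x i = x (i + Nat.gcd p q) := by
      intro x p q L hpq hk hp hq hL h1 h2
      obtain ⟨d, rfl⟩ : ∃ d, q = p + d := ⟨q - p, by omega⟩
      have hg : Nat.gcd p (p + d) = Nat.gcd p d := by simp
      rw [hg] at hL ⊢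
      have hgd : Nat.gcd p d ≤ d := Nat.gcd_le_right _ (by omega)
      have hgp : Nat.gcd p d ≤ p := Nat.gcd_le_left _ (by omega)
      have hg0 : 0 < Nat.gcd p d := Nat.gcd_pos_of_pos_left _ (by omega)
      have hP := ih x p d (L - p) (by omega) hp (by omega) (by omega)
        (fun i hi => h1 i (by omega))
        (fun i hi => by
          have a := h2 i (by omega)
          have b := h1 (i + d) (by omega)
          rw [a, b]; congr 1; omega)
      intro i
      induction i using Nat.strong_induction_on with
      | _ i ihi =>
        intro hi
        by_cases hlt : i + Nat.gcd p d < L - p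
        · exact hP i hlt
        · by_cases hip : p ≤ i
          · obtain ⟨j, rfl⟩ : ∃ j, i = j + p := ⟨i - p, by omega⟩
            have := ihi j (by omega) (by omega)
            rw [← h1 j (by omega), this, h1 (j + Nat.gcd p d) (by omega)]
            congr 1; omega
          · obtain ⟨c, hc⟩ := Nat.gcd_dvd_left p d
            set g := Nat.gcd p d with hgdef
            obtain ⟨j, hj⟩ : ∃ j, i + g = j + p := ⟨i + g - p, by omega⟩
            rw [hj, ← h1 j (by omega)]
            obtain ⟨c', rfl⟩ : ∃ c', c = c' + 1 := by
              cases c with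
              | zero => omega
              | succ c' => exact ⟨c', rfl⟩
            have hc2 : p = c' * g + g := by rw [hc]; ring
            have hi2 : i = j + c' * g := by omega
            rw [hi2]
            exact (period_mul x g (L - p) hP c' j (by omega)).symm
    intro x p q L hk hp hq hL h1 h2
    rcases lt_trichotomy p q with h | h | h
    · exact main x p q L h hk hp hq hL h1 h2
    · subst h; simpa using h1
    · have := main x q p L h (by omega) hq hp (by rw [Nat.gcd_comm]; omega) h2 h1
      rwa [Nat.gcd_comm] at this

/-- The key word lemma: early repetitions of all lengths force very early repetitions. -/
lemma exists_good_rep (x : ℕ → ℕ)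
    (hx : ∀ g, 1 ≤ g → ∃ i, x i ≠ x (i + g))
    (hrep : ∀ n, 1 ≤ n → ∃ u v : ℕ, 1 ≤ v ∧ u + v ≤ n + 1 ∧ ∀ i < n, x (u + i) = x (u + v + i))
    (t : ℕ) :
    ∃ n u v : ℕ, 1 ≤ v ∧ u + v + t ≤ n ∧ ∀ i < n, x (u + i) = x (u + v + i) := by
  by_contra hcon
  have H : ∀ n u v : ℕ, 1 ≤ v → (∀ i < n, x (u + i) = x (u + v + i)) → n < u + v + t := by
    intro n u v hv h
    by_contra h'
    exact hcon ⟨n, u, v, hv, by omega, h⟩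
  -- minimal repetitions with maximal agreement
  have step1 : ∀ n, 1 ≤ n → ∃ u v l : ℕ, 1 ≤ v ∧ u + v ≤ n + 1 ∧ n ≤ l ∧ l < u + v + t ∧
      (∀ i < l, x (u + i) = x (u + v + i)) ∧ x (u + l) ≠ x (u + v + l) ∧
      (∀ u' v', 1 ≤ v' → (∀ i < n, x (u' + i) = x (u' + v' + i)) → u + v ≤ u' + v') := by
    intro n hn
    classical
    have hex : ∃ m, ∃ u v, 1 ≤ v ∧ u + v = m ∧ ∀ i < n, x (u + i) = x (u + v + i) := by
      obtain ⟨u, v, hv, _, h⟩ := hrep n hn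
      exact ⟨u + v, u, v, hv, rfl, h⟩
    obtain ⟨u, v, hv, hm, huv⟩ := Nat.find_spec hex
    have hmin : ∀ u' v', 1 ≤ v' → (∀ i < n, x (u' + i) = x (u' + v' + i)) →
        u + v ≤ u' + v' := by
      intro u' v' hv' h'
      rw [hm]
      exact Nat.find_min' hex ⟨u', v', hv', rfl, h'⟩
    have hex2 : ∃ l, x (u + l) ≠ x (u + v + l) := by
      by_contra hno
      have hno' : ∀ l, x (u + l) = x (u + v + l) := by
        intro l; by_contra h; exact hno ⟨l, h⟩
      have := H (u + v + t) u v hv (fun i _ => hno' i)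
      omega
    have hl := Nat.find_spec hex2
    have hl2 : ∀ i < Nat.find hex2, x (u + i) = x (u + v + i) := by
      intro i hi
      have := Nat.find_min hex2 hi
      simpa using this
    refine ⟨u, v, Nat.find hex2, hv, ?_, ?_, H _ u v hv hl2, hl2, hl, hmin⟩
    · obtain ⟨u', v', hv', h1, h2⟩ := hrep n hn
      have := hmin u' v' hv' h2
      omega
    · by_contra hlt
      exact hl (huv _ (by omega))
  -- repetitions starting at `0`
  have step2 : ∀ n, 1 ≤ n → ∃ v l : ℕ, 1 ≤ v ∧ v ≤ n + t + 3 ∧ n ≤ l ∧ l < v + t ∧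
      (∀ i < l, x i = x (v + i)) ∧ x l ≠ x (v + l) := by
    intro n hn
    obtain ⟨u, v, l, hv, huv, hnl, hlt, hag, hne, hmin⟩ := step1 n hn
    obtain ⟨u', v', l', hv', huv', hnl', hlt', hag', hne', _⟩ := step1 (l + 1) (by omega)
    have hmm : u + v ≤ u' + v' := hmin u' v' hv' (fun i hi => hag' i (by omega))
    by_cases hu : u = 0
    · subst hu
      exact ⟨v, l, hv, by omega, hnl, by omega, by simpa using hag, by simpa using hne⟩
    by_cases hu' : u' = 0
    · subst hu'
      exact ⟨v', l', hv', by omega, by omega, by omega, by simpa using hag', by simpa using hne'⟩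
    exfalso
    set w := max u u' with hw
    have hwu : u ≤ w := le_max_left _ _
    have hwu' : u' ≤ w := le_max_right _ _
    have hww : w = u ∨ w = u' := by rcases max_choice u u' with h | h <;> simp [hw, h]
    have hg1 : 0 < Nat.gcd v v' := Nat.gcd_pos_of_pos_left _ (by omega)
    have hlen : v + v' ≤ (u + v + l - w) + 1 := by rcases hww with h | h <;> omega
    have hfw := fine_wilf (v + v') (fun i => x (w + i)) v v' (u + v + l - w) le_rfl hv hv'
      (by omega)
      (fun i hi => by
        have := hag (w + i - u) (by omega)
        rw [show u + (w + i - u) = w + i by omega,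
          show u + v + (w + i - u) = w + (i + v) by omega] at this
        exact this)
      (fun i hi => by
        have := hag' (w + i - u') (by omega)
        rw [show u' + (w + i - u') = w + i by omega,
          show u' + v' + (w + i - u') = w + (i + v') by omega] at this
        exact this)
    have hper := period_mul (fun i => x (w + i)) (Nat.gcd v v') (u + v + l - w) hfw
    obtain ⟨c, hc⟩ := Nat.gcd_dvd_left v v'
    obtain ⟨c', hc'⟩ := Nat.gcd_dvd_right v v'
    have hdiff : x (u + v + l - v') = x (u + l) := by
      rcases le_total v v' with hvv | hvv
      · have hcc : c ≤ c' := by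
          by_contra h
          have : Nat.gcd v v' * c' < Nat.gcd v v' * c := Nat.mul_lt_mul_of_pos_left (by omega) hg1
          omega
        have hm : (c' - c) * Nat.gcd v v' = v' - v := by
          rw [Nat.sub_mul, mul_comm c', mul_comm c, ← hc, ← hc']
        have := hper (c' - c) (u + v + l - v' - w) (by rw [hm]; omega)
        simp only [hm] at this
        rw [show w + (u + v + l - v' - w) = u + v + l - v' by omega,
          show w + (u + v + l - v' - w + (v' - v)) = u + l by omega] at this
        exact this
      · have hcc : c' ≤ c := by
          by_contra h
          have : Nat.gcd v v' * c < Nat.gcd v v' * c' := Nat.mul_lt_mul_of_pos_left (by omega) hg1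
          omega
        have hm : (c - c') * Nat.gcd v v' = v - v' := by
          rw [Nat.sub_mul, mul_comm c', mul_comm c, ← hc, ← hc']
        have := hper (c - c') (u + l - w) (by rw [hm]; omega)
        simp only [hm] at this
        rw [show w + (u + l - w) = u + l by omega,
          show w + (u + l - w + (v - v')) = u + v + l - v' by omega] at this
        exact this.symm
    have h1 := hag' (u + v + l - v' - u') (by omega)
    rw [show u' + (u + v + l - v' - u') = u + v + l - v' by omega,
      show u' + v' + (u + v + l - v' - u') = u + v + l by omega] at h1
    exact hne (by rw [← hdiff, h1])
  -- small periods of all prefixes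
  have step3 : ∀ n, 1 ≤ n → ∃ g, 1 ≤ g ∧ g ≤ 4 * t + 10 ∧ ∀ i, i + g < n → x i = x (i + g) := by
    intro n hn
    obtain ⟨v, l, hv, hvn, hnl, hlt, hag, hne⟩ := step2 n hn
    obtain ⟨v', l', hv', hvn', hnl', hlt', hag', hne'⟩ := step2 (l + 1) (by omega)
    have hvv : v ≠ v' := by
      rintro rfl
      exact hne (hag' l (by omega))
    rcases lt_or_gt_of_ne hvv with h | h
    · refine ⟨v' - v, by omega, by omega, fun i hi => ?_⟩
      have a := hag' i (by omega)
      have b := hag (i + (v' - v)) (by omega)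
      rw [a, b]; congr 1; omega
    · refine ⟨v - v', by omega, by omega, fun i hi => ?_⟩
      have a := hag i (by omega)
      have b := hag' (i + (v - v')) (by omega)
      rw [a, b]; congr 1; omega
  obtain ⟨i, hi⟩ := hx (Nat.factorial (4 * t + 10)) (Nat.factorial_pos _)
  obtain ⟨g, hg, hgt, hper⟩ := step3 (i + Nat.factorial (4 * t + 10) + 1) (by omega)
  obtain ⟨c, hc⟩ := Nat.dvd_factorial hg hgt
  have := period_mul x g _ hper c i (by rw [mul_comm, ← hc]; omega)
  rw [mul_comm, ← hc] at this
  exact hi this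

lemma bdigit_step (b : ℕ) (ξ : ℝ) (k : ℕ) :
    Int.fract ((b : ℝ) ^ (k + 1) * Int.fract ξ) =
      b * Int.fract ((b : ℝ) ^ k * Int.fract ξ) - bdigit b ξ k := by
  have h0 : 0 ≤ ⌊(b : ℝ) * Int.fract ((b : ℝ) ^ k * Int.fract ξ)⌋ :=
    Int.floor_nonneg.mpr (mul_nonneg (Nat.cast_nonneg _) (Int.fract_nonneg _))
  have h1 : ((bdigit b ξ k : ℕ) : ℝ) = (⌊(b : ℝ) * Int.fract ((b : ℝ) ^ k * Int.fract ξ)⌋ : ℤ) := by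
    unfold bdigit
    rw [← Int.cast_natCast, Int.toNat_of_nonneg h0]
  have h2 : (b : ℝ) ^ (k + 1) * Int.fract ξ =
      (b : ℝ) * Int.fract ((b : ℝ) ^ k * Int.fract ξ) +
        (((b : ℤ) * ⌊(b : ℝ) ^ k * Int.fract ξ⌋ : ℤ) : ℝ) := by
    push_cast
    rw [← mul_add, Int.fract_add_floor]
    ring
  rw [h1, h2, Int.fract_add_intCast]
  exact (Int.self_sub_floor _).symm

lemma bdigit_close (b : ℕ) (hb : 2 ≤ b) (ξ : ℝ) (n : ℕ) : ∀ u w : ℕ,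
    (∀ i < n, bdigit b ξ (u + i) = bdigit b ξ (w + i)) →
    |Int.fract ((b : ℝ) ^ w * Int.fract ξ) - Int.fract ((b : ℝ) ^ u * Int.fract ξ)| * (b : ℝ) ^ n
      < 1 := by
  have hb0 : (0 : ℝ) < b := by positivity
  induction n with
  | zero =>
    intro u w _
    have h1 := Int.fract_nonneg ((b : ℝ) ^ w * Int.fract ξ)
    have h2 := Int.fract_lt_one ((b : ℝ) ^ w * Int.fract ξ)
    have h3 := Int.fract_nonneg ((b : ℝ) ^ u * Int.fract ξ)
    have h4 := Int.fract_lt_one ((b : ℝ) ^ u * Int.fract ξ)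
    rw [pow_zero, mul_one, abs_lt]
    constructor <;> linarith
  | succ n ih =>
    intro u w h
    have h1 := ih (u + 1) (w + 1) (fun i hi => by
      have := h (i + 1) (by omega)
      rw [show u + 1 + i = u + (i + 1) by ring, show w + 1 + i = w + (i + 1) by ring]
      exact this)
    have h0 : bdigit b ξ u = bdigit b ξ w := h 0 (by omega)
    rw [bdigit_step, bdigit_step, h0] at h1
    have e : (b : ℝ) * Int.fract ((b : ℝ) ^ w * Int.fract ξ) - bdigit b ξ w -
        (b * Int.fract ((b : ℝ) ^ u * Int.fract ξ) - bdigit b ξ w) =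
        b * (Int.fract ((b : ℝ) ^ w * Int.fract ξ) - Int.fract ((b : ℝ) ^ u * Int.fract ξ)) := by
      ring
    rw [e, abs_mul, abs_of_pos hb0] at h1
    rw [pow_succ]
    calc _ = _ := by ring
      _ < 1 := h1

lemma fract_diff (b : ℕ) (ξ : ℝ) (u v : ℕ) : ∃ P : ℤ,
    Int.fract ((b : ℝ) ^ (u + v) * Int.fract ξ) - Int.fract ((b : ℝ) ^ u * Int.fract ξ) =
      (b : ℝ) ^ u * ((b : ℝ) ^ v - 1) * ξ - P := by
  refine ⟨(b : ℤ) ^ u * ((b : ℤ) ^ v - 1) * ⌊ξ⌋ + ⌊(b : ℝ) ^ (u + v) * Int.fract ξ⌋ -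
    ⌊(b : ℝ) ^ u * Int.fract ξ⌋, ?_⟩
  push_cast
  have h1 := Int.fract_add_floor ((b : ℝ) ^ (u + v) * Int.fract ξ)
  have h2 := Int.fract_add_floor ((b : ℝ) ^ u * Int.fract ξ)
  have h3 := Int.fract_add_floor ξ
  have h4 : Int.fract ((b : ℝ) ^ (u + v) * Int.fract ξ) =
    (b : ℝ) ^ (u + v) * Int.fract ξ - ⌊(b : ℝ) ^ (u + v) * Int.fract ξ⌋ := by linarith
  have h5 : Int.fract ((b : ℝ) ^ u * Int.fract ξ) =
    (b : ℝ) ^ u * Int.fract ξ - ⌊(b : ℝ) ^ u * Int.fract ξ⌋ := by linarith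
  have h6 : ξ = Int.fract ξ + ⌊ξ⌋ := h3.symm
  rw [h4, h5]
  conv_rhs => rw [h6]
  simp only [Int.floor_add_intCast, Int.floor_fract, zero_add, Int.fract_add_intCast,
    Int.fract_fract]
  rw [pow_add]
  ring

lemma bdigit_approx (b : ℕ) (hb : 2 ≤ b) (ξ : ℝ) (n u v : ℕ)
    (h : ∀ i < n, bdigit b ξ (u + i) = bdigit b ξ (u + v + i)) :
    ∃ P : ℤ, |(b : ℝ) ^ u * ((b : ℝ) ^ v - 1) * ξ - P| * (b : ℝ) ^ n < 1 := by
  obtain ⟨P, hP⟩ := fract_diff b ξ u v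
  refine ⟨P, ?_⟩
  rw [← hP]
  exact bdigit_close b hb ξ n u (u + v) h

lemma bdigit_not_periodic (b : ℕ) (hb : 2 ≤ b) (ξ : ℝ) (hξ : Irrational ξ) (g : ℕ) (hg : 1 ≤ g) :
    ∃ i, bdigit b ξ i ≠ bdigit b ξ (i + g) := by
  by_contra hcon
  have hper : ∀ i, bdigit b ξ i = bdigit b ξ (i + g) := by
    intro i; by_contra h; exact hcon ⟨i, h⟩
  obtain ⟨P, hP⟩ := fract_diff b ξ 0 g
  have hb1 : (1 : ℝ) < b := by exact_mod_cast (by omega : 1 < b)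
  have hz : |Int.fract ((b : ℝ) ^ (0 + g) * Int.fract ξ) -
      Int.fract ((b : ℝ) ^ 0 * Int.fract ξ)| = 0 := by
    by_contra hne
    have hpos := lt_of_le_of_ne (abs_nonneg _) (Ne.symm hne)
    obtain ⟨n, hn⟩ := pow_unbounded_of_one_lt (1 / |Int.fract ((b : ℝ) ^ (0 + g) * Int.fract ξ) -
      Int.fract ((b : ℝ) ^ 0 * Int.fract ξ)|) hb1
    have := bdigit_close b hb ξ n 0 (0 + g) (fun i _ => by
      rw [show 0 + i = i by ring, show 0 + g + i = i + g by ring]; exact hper i)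
    rw [div_lt_iff₀ hpos] at hn
    linarith
  rw [abs_eq_zero, hP] at hz
  have hQ : (b : ℝ) ^ 0 * ((b : ℝ) ^ g - 1) ≠ 0 := by
    have : (1 : ℝ) < (b : ℝ) ^ g := one_lt_pow₀ hb1 (by omega)
    rw [pow_zero, one_mul]; linarith
  have hirr : Irrational (((b ^ g - 1 : ℤ) : ℝ) * ξ) := hξ.intCast_mul (by
    intro h0
    apply hQ
    have : (((b : ℤ) ^ g - 1 : ℤ) : ℝ) = 0 := by rw [h0]; simp
    push_cast at this
    rw [pow_zero, one_mul, this])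
  apply hirr
  refine ⟨(P : ℚ), ?_⟩
  push_cast
  rw [pow_zero, one_mul] at hz
  linarith

/-- Matching with a very good rational approximation. -/
lemma matching (b : ℕ) (hb : 2 ≤ b) (ξ : ℝ)
    (hrep : ∀ n, 1 ≤ n → ∃ u v : ℕ, 1 ≤ v ∧ u + v ≤ n + 1 ∧ ∃ P : ℤ,
      |(b : ℝ) ^ u * ((b : ℝ) ^ v - 1) * ξ - P| * (b : ℝ) ^ n < 1)
    (q : ℕ) (p : ℤ) (hq : 1 ≤ q) (hcop : IsCoprime (q : ℤ) p)
    (hsmall : 4 * (b : ℝ) ^ 2 * q * |q * ξ - p| ≤ 1) :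
    ∃ u v A : ℕ, 1 ≤ v ∧ 1 ≤ A ∧ A ≤ 2 * b ^ 2 ∧ b ^ u * (b ^ v - 1) = A * q := by
  classical
  have hex : ∃ n, 2 * q ≤ b ^ n := by
    refine ⟨2 * q, ?_⟩
    exact (Nat.lt_pow_self (by omega)).le
  set n := Nat.find hex with hn
  have h1 : 2 * q ≤ b ^ n := Nat.find_spec hex
  have hn1 : 1 ≤ n := by
    by_contra h0
    have : n = 0 := by omega
    rw [this, pow_zero] at h1; omega
  have h2 : b ^ (n - 1) < 2 * q := by
    have := Nat.find_min hex (show n - 1 < Nat.find hex by omega)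
    omega
  obtain ⟨u, v, hv, huv, P, hP⟩ := hrep n hn1
  have hbv : 1 < b ^ v := Nat.one_lt_pow (by omega) (by omega)
  set Q : ℕ := b ^ u * (b ^ v - 1) with hQ
  have hQpos : 0 < Q := Nat.mul_pos (by positivity) (by omega)
  have hQr : (Q : ℝ) = (b : ℝ) ^ u * ((b : ℝ) ^ v - 1) := by
    rw [hQ]; push_cast [Nat.cast_sub hbv.le]; ring
  have hQle : Q ≤ 2 * b ^ 2 * q := by
    calc Q ≤ b ^ u * b ^ v := Nat.mul_le_mul_left _ (by omega)
      _ = b ^ (u + v) := (pow_add _ _ _).symm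
      _ ≤ b ^ (n + 1) := Nat.pow_le_pow_right (by omega) huv
      _ = b ^ 2 * b ^ (n - 1) := by rw [← pow_add]; congr 1; omega
      _ ≤ b ^ 2 * (2 * q) := Nat.mul_le_mul_left _ h2.le
      _ = 2 * b ^ 2 * q := by ring
  rw [← hQr] at hP
  have hdet : ((q : ℤ) * P - Q * p) = 0 := by
    have hr : |(((q : ℤ) * P - Q * p : ℤ) : ℝ)| < 1 := by
      have e : (((q : ℤ) * P - Q * p : ℤ) : ℝ) = Q * (q * ξ - p) - q * (Q * ξ - P) := by
        push_cast; ring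
      rw [e]
      have ha : |(Q : ℝ) * (q * ξ - p)| ≤ 1 / 2 := by
        rw [abs_mul, abs_of_nonneg (Nat.cast_nonneg _)]
        have : (Q : ℝ) ≤ 2 * b ^ 2 * q := by exact_mod_cast hQle
        have := mul_le_mul_of_nonneg_right this (abs_nonneg (q * ξ - p))
        nlinarith
      have hbb : |(q : ℝ) * (Q * ξ - P)| < 1 / 2 := by
        rw [abs_mul, abs_of_nonneg (Nat.cast_nonneg _)]
        have h1' : (2 : ℝ) * q ≤ b ^ n := by exact_mod_cast h1
        have := mul_le_mul_of_nonneg_right h1' (abs_nonneg (Q * ξ - P))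
        nlinarith
      have := abs_sub (Q * (q * ξ - p)) (q * (Q * ξ - P))
      linarith
    rw [← Int.cast_abs] at hr
    have : |(q : ℤ) * P - Q * p| < 1 := by exact_mod_cast hr
    exact Int.abs_lt_one_iff.mp this
  have hdvd : (q : ℤ) ∣ Q := by
    apply hcop.dvd_of_dvd_mul_right
    exact ⟨P, by linarith⟩
  obtain ⟨A, hA⟩ := Int.natCast_dvd_natCast.mp hdvd
  refine ⟨u, v, A, hv, ?_, ?_, by rw [← hQ, hA, mul_comm]⟩
  · rcases Nat.eq_zero_or_pos A with h | h
    · rw [h] at hA; omega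
    · exact h
  · rw [hA] at hQle
    exact Nat.le_of_mul_le_mul_left (by linarith) hq

/-- Coefficients of the Padé approximants to the sixth root. -/
noncomputable def padeC (n i l : ℕ) : ℝ :=
  (-1) ^ (i + l) * (n.choose i) * (n.choose l) / (6 * ((i : ℝ) - l) + 1)

noncomputable def padeA (n : ℕ) (y : ℝ) : ℝ :=
  ∑ i ∈ Finset.range (n + 1), ∑ l ∈ Finset.range (n + 1), padeC n i l * y ^ i

noncomputable def padeB (n : ℕ) (y : ℝ) : ℝ :=
  ∑ i ∈ Finset.range (n + 1), ∑ l ∈ Finset.range (n + 1), padeC n i l * y ^ l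

lemma pade_den_ne (i l : ℕ) : (6 * ((i : ℝ) - l) + 1) ≠ 0 := by
  intro h
  have : (6 * ((i : ℤ) - l) + 1 : ℤ) = 0 := by exact_mod_cast h
  omega

lemma pade_integral (n : ℕ) (x : ℝ) (hx : 0 < x) :
    ∫ t in (1 : ℝ)..x, ((t ^ 6 - 1) * ((x / t) ^ 6 - 1)) ^ n =
      x * padeA n (x ^ 6) - padeB n (x ^ 6) := by
  have h0 : (0 : ℝ) ∉ Set.uIcc 1 x := by
    intro h
    rw [Set.mem_uIcc] at h
    rcases h with h | h <;> linarith [h.1, h.2]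
  have hpos : ∀ t ∈ Set.uIcc 1 x, 0 < t := by
    intro t ht
    rw [Set.mem_uIcc] at ht
    rcases ht with h | h <;> linarith [h.1, h.2]
  have hexp : ∀ t ∈ Set.uIcc 1 x, ((t ^ 6 - 1) * ((x / t) ^ 6 - 1)) ^ n =
      ∑ i ∈ Finset.range (n + 1), ∑ l ∈ Finset.range (n + 1),
        ((-1) ^ (i + l) * (n.choose i) * (n.choose l) * x ^ (6 * l)) *
          t ^ (6 * ((i : ℤ) - l)) := by
    intro t ht
    have htp := hpos t ht
    rw [mul_pow, sub_eq_add_neg, sub_eq_add_neg, add_pow, add_pow, Finset.sum_mul_sum]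
    refine Finset.sum_congr rfl fun i hi => Finset.sum_congr rfl fun l hl => ?_
    rw [Finset.mem_range] at hi hl
    have hs : ((-1 : ℝ)) ^ (n - i) * (-1) ^ (n - l) = (-1) ^ (i + l) := by
      rw [← pow_add]
      have : n - i + (n - l) + (i + l) = 2 * n := by omega
      have h2 : ((-1 : ℝ)) ^ (n - i + (n - l)) * (-1) ^ (i + l) = 1 := by
        rw [← pow_add, this, pow_mul]; simp
      have h3 : ((-1 : ℝ)) ^ (i + l) * (-1) ^ (i + l) = 1 := by
        rw [← mul_pow]; simp
      calc _ = ((-1 : ℝ)) ^ (n - i + (n - l)) * ((-1 : ℝ) ^ (i + l) * (-1) ^ (i + l)) := by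
            rw [h3, mul_one]
        _ = _ := by rw [← mul_assoc, h2, one_mul]
    have ht : t ^ (6 * ((i : ℤ) - l)) = t ^ (6 * i) / t ^ (6 * l) := by
      rw [mul_sub, zpow_sub₀ htp.ne']
      norm_cast
    rw [ht, ← hs, ← pow_mul, ← pow_mul, div_pow]
    ring
  rw [intervalIntegral.integral_congr hexp]
  have hint : ∀ i l : ℕ, IntervalIntegrable (fun t : ℝ =>
      ((-1) ^ (i + l) * (n.choose i) * (n.choose l) * x ^ (6 * l)) * t ^ (6 * ((i : ℤ) - l)))
      MeasureTheory.volume 1 x := by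
    intro i l
    apply IntervalIntegrable.const_mul
    exact intervalIntegral.intervalIntegrable_zpow (Or.inr h0)
  rw [intervalIntegral.integral_finsetSum]
  swap
  · intro i _
    have hsum := IntervalIntegrable.sum (Finset.range (n + 1)) (fun l _ => hint i l)
    rw [show (fun t : ℝ => ∑ l ∈ Finset.range (n + 1),
      ((-1) ^ (i + l) * (n.choose i) * (n.choose l) * x ^ (6 * l)) * t ^ (6 * ((i : ℤ) - l))) =
      ∑ l ∈ Finset.range (n + 1), (fun t : ℝ =>
      ((-1) ^ (i + l) * (n.choose i) * (n.choose l) * x ^ (6 * l)) * t ^ (6 * ((i : ℤ) - l))) by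
        funext t; simp [Finset.sum_apply]]
    exact hsum
  unfold padeA padeB
  rw [Finset.mul_sum, ← Finset.sum_sub_distrib]
  refine Finset.sum_congr rfl fun i hi => ?_
  rw [intervalIntegral.integral_finsetSum (fun l _ => hint i l)]
  rw [Finset.mul_sum, ← Finset.sum_sub_distrib]
  refine Finset.sum_congr rfl fun l hl => ?_
  rw [intervalIntegral.integral_const_mul, integral_zpow (Or.inr ⟨by omega, h0⟩)]
  have hz : x ^ (6 * ((i : ℤ) - l) + 1) = x * x ^ (6 * i) / x ^ (6 * l) := by
    rw [zpow_add₀ hx.ne', mul_sub, zpow_sub₀ hx.ne', zpow_one]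
    norm_cast
    ring
  rw [hz, one_zpow]
  unfold padeC
  have hd := pade_den_ne i l
  push_cast
  rw [← pow_mul, ← pow_mul]
  field_simp

/-- Partial fractions. -/
lemma partial_frac (n : ℕ) : ∀ z : ℝ, (∀ k : ℤ, z ≠ k) →
    ∑ l ∈ Finset.range (n + 1), (-1 : ℝ) ^ l * (n.choose l) / (z - l) =
      (-1) ^ n * n.factorial / ∏ l ∈ Finset.range (n + 1), (z - l) := by
  induction n with
  | zero => intro z hz; simp
  | succ n ih =>
    intro z hz
    have hz' : ∀ k : ℤ, z - 1 ≠ k := by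
      intro k hk
      exact hz (k + 1) (by push_cast; linarith)
    have hne : ∀ l : ℕ, z - l ≠ 0 := fun l h => hz l (by push_cast; linarith)
    have h1 := ih z hz
    have h2 := ih (z - 1) hz'
    have hrec : ∑ l ∈ Finset.range (n + 1 + 1), (-1 : ℝ) ^ l * ((n + 1).choose l) / (z - l) =
        ∑ l ∈ Finset.range (n + 1), (-1 : ℝ) ^ l * (n.choose l) / (z - l) -
        ∑ l ∈ Finset.range (n + 1), (-1 : ℝ) ^ l * (n.choose l) / (z - 1 - l) := by
      rw [Finset.sum_range_succ']
      have ha : ∀ l ∈ Finset.range (n + 1),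
          (-1 : ℝ) ^ (l + 1) * ((n + 1).choose (l + 1) : ℕ) / (z - (l + 1 : ℕ)) =
          (-1 : ℝ) ^ (l + 1) * (n.choose (l + 1) : ℕ) / (z - (l + 1 : ℕ)) -
          (-1 : ℝ) ^ l * (n.choose l) / (z - 1 - l) := by
        intro l _
        rw [Nat.choose_succ_succ']
        push_cast
        rw [show z - ((l : ℝ) + 1) = z - 1 - l by ring]
        ring
      rw [Finset.sum_congr rfl ha, Finset.sum_sub_distrib]
      have hb := Finset.sum_range_succ' (fun l : ℕ => (-1 : ℝ) ^ l * (n.choose l) / (z - l)) (n + 1)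
      rw [Finset.sum_range_succ] at hb
      simp only [Nat.choose_succ_self, Nat.cast_zero, mul_zero, zero_div, add_zero] at hb
      rw [hb]
      simp only [Nat.choose_zero_right, pow_zero, Nat.cast_zero, Nat.cast_one]
      ring
    rw [hrec, h1, h2]
    have hp1 : ∏ l ∈ Finset.range (n + 1 + 1), (z - (l : ℝ)) =
        (∏ l ∈ Finset.range (n + 1), (z - (l : ℝ))) * (z - (n + 1 : ℕ)) := Finset.prod_range_succ _ _
    have hp2 : ∏ l ∈ Finset.range (n + 1 + 1), (z - (l : ℝ)) =
        (∏ l ∈ Finset.range (n + 1), (z - 1 - (l : ℝ))) * z := by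
      rw [Finset.prod_range_succ']
      congr 1
      · refine Finset.prod_congr rfl fun l _ => ?_
        push_cast; ring
      · simp
    set D := ∏ l ∈ Finset.range (n + 1 + 1), (z - (l : ℝ)) with hD
    set D1 := ∏ l ∈ Finset.range (n + 1), (z - (l : ℝ)) with hD1
    set D2 := ∏ l ∈ Finset.range (n + 1), (z - 1 - (l : ℝ)) with hD2
    have hDne : D ≠ 0 := Finset.prod_ne_zero_iff.mpr fun l _ => hne l
    have hz0 : z ≠ 0 := by simpa using hne 0
    have hzn : z - (n + 1 : ℕ) ≠ 0 := hne (n + 1)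
    have hD1' : D1 = D / (z - (n + 1 : ℕ)) := by rw [hp1]; field_simp
    have hD2' : D2 = D / z := by rw [hp2]; field_simp
    rw [hD1', hD2', Nat.factorial_succ]
    field_simp
    push_cast
    ring

/-- The coefficient of `y ^ i` in `padeA n`. -/
noncomputable def padeCoef (n i : ℕ) : ℝ := ∑ l ∈ Finset.range (n + 1), padeC n i l

lemma padeCoef_eq (n i : ℕ) : padeCoef n i = (-1) ^ i * (n.choose i) / 6 *
    ((-1) ^ n * n.factorial / ∏ l ∈ Finset.range (n + 1), ((i : ℝ) + 1 / 6 - l)) := by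
  rw [← partial_frac n ((i : ℝ) + 1 / 6)]
  · unfold padeCoef padeC
    rw [Finset.mul_sum]
    refine Finset.sum_congr rfl fun l _ => ?_
    have hd := pade_den_ne i l
    have h2 : (i : ℝ) + 1 / 6 - l = (6 * ((i : ℝ) - l) + 1) / 6 := by ring
    rw [h2, pow_add]
    field_simp
  · intro k hk
    have h : (6 * (i : ℤ) + 1 : ℤ) = 6 * k := by
      have : (6 * (i : ℝ) + 1) = 6 * k := by linarith
      exact_mod_cast this
    omega

lemma padeCoef_pos_mono (i : ℕ) : ∀ n, i ≤ n → 0 < padeCoef n i ∧ padeCoef n i ≤ padeCoef (n + 1) i := by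
  have hstep : ∀ n, i ≤ n → 0 < padeCoef n i → padeCoef n i ≤ padeCoef (n + 1) i := by
    intro n hin hpos
    have hrat : padeCoef (n + 1) i = padeCoef n i *
        (((n : ℝ) + 1) / ((n : ℝ) + 1 - i) * (((n : ℝ) + 1) / ((n : ℝ) + 1 - i - 1 / 6))) := by
      rw [padeCoef_eq, padeCoef_eq, Finset.prod_range_succ _ (n + 1), Nat.factorial_succ]
      have hch : ((n + 1).choose i : ℝ) * ((n : ℝ) + 1 - i) = ((n : ℝ) + 1) * (n.choose i) := by
        have := Nat.choose_mul_succ_eq n i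
        have h2 : ((n + 1 - i : ℕ) : ℝ) = (n : ℝ) + 1 - i := by
          push_cast [Nat.cast_sub (by omega : i ≤ n + 1)]; ring
        rw [← h2]
        have h3 : ((n.choose i * (n + 1) : ℕ) : ℝ) = (((n + 1).choose i * (n + 1 - i) : ℕ) : ℝ) := by
          exact_mod_cast this
        push_cast at h3 ⊢
        linarith
      have hi : (i : ℝ) ≤ n := by exact_mod_cast hin
      have e1 : (n : ℝ) + 1 - i ≠ 0 := by linarith
      have hch' : ((n + 1).choose i : ℝ) = ((n : ℝ) + 1) * (n.choose i) / ((n : ℝ) + 1 - i) := by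
        rw [eq_div_iff e1, hch]
      rw [hch']
      have e2 : (n : ℝ) + 1 - i - 1 / 6 ≠ 0 := by
        have : 0 < (n : ℝ) + 1 - i - 1 / 6 := by linarith
        exact this.ne'
      have e3 : (i : ℝ) + 1 / 6 - (n + 1 : ℕ) = - ((n : ℝ) + 1 - i - 1 / 6) := by push_cast; ring
      rw [e3]
      have e4 : ∏ l ∈ Finset.range (n + 1), ((i : ℝ) + 1 / 6 - l) ≠ 0 := by
        rw [Finset.prod_ne_zero_iff]
        intro l _ h
        exact pade_den_ne i l (by linarith)
      set D := ∏ l ∈ Finset.range (n + 1), ((i : ℝ) + 1 / 6 - l)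
      set w := (n : ℝ) + 1 - i - 1 / 6 with hw
      set w1 := (n : ℝ) + 1 - i with hw1
      push_cast
      rw [pow_succ]
      field_simp
    rw [hrat]
    have hi : (i : ℝ) ≤ n := by exact_mod_cast hin
    have hi0 : (0 : ℝ) ≤ i := Nat.cast_nonneg _
    have f1 : 1 ≤ ((n : ℝ) + 1) / ((n : ℝ) + 1 - i) := by
      rw [one_le_div (by linarith)]; linarith
    have f2 : 1 ≤ ((n : ℝ) + 1) / ((n : ℝ) + 1 - i - 1 / 6) := by
      rw [one_le_div (by linarith)]; linarith
    exact le_mul_of_one_le_right hpos.le (one_le_mul_of_one_le_of_one_le f1 f2)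
  have hbase : 0 < padeCoef i i := by
    rw [padeCoef_eq]
    have hp : 0 < ∏ l ∈ Finset.range (i + 1), ((i : ℝ) + 1 / 6 - l) := by
      apply Finset.prod_pos
      intro l hl
      rw [Finset.mem_range] at hl
      have : (l : ℝ) ≤ i := by exact_mod_cast (by omega : l ≤ i)
      linarith
    have hs : ((-1 : ℝ) ^ i) * (-1) ^ i = 1 := by rw [← mul_pow]; simp
    have e : (-1 : ℝ) ^ i * (i.choose i) / 6 *
        ((-1) ^ i * i.factorial / ∏ l ∈ Finset.range (i + 1), ((i : ℝ) + 1 / 6 - l)) =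
        (((-1 : ℝ) ^ i) * (-1) ^ i) * ((i.factorial : ℝ) / 6 /
          ∏ l ∈ Finset.range (i + 1), ((i : ℝ) + 1 / 6 - l)) := by
      rw [Nat.choose_self]; push_cast; ring
    rw [e, hs, one_mul]
    positivity
  have hpos : ∀ n, i ≤ n → 0 < padeCoef n i := by
    intro n hn
    induction n, hn using Nat.le_induction with
    | base => exact hbase
    | succ n hn ih => exact lt_of_lt_of_le ih (hstep n hn ih)
  exact fun n hn => ⟨hpos n hn, hstep n hn (hpos n hn)⟩

lemma padeA_eq (n : ℕ) (y : ℝ) :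
    padeA n y = ∑ i ∈ Finset.range (n + 1), padeCoef n i * y ^ i := by
  unfold padeA padeCoef
  refine Finset.sum_congr rfl fun i _ => ?_
  rw [Finset.sum_mul]

lemma padeA_pos (n : ℕ) (y : ℝ) (hy : 0 < y) : 0 < padeA n y := by
  rw [padeA_eq]
  apply Finset.sum_pos
  · intro i hi
    rw [Finset.mem_range] at hi
    exact mul_pos (padeCoef_pos_mono i n (by omega)).1 (by positivity)
  · exact ⟨0, by simp⟩

lemma padeA_mono (n : ℕ) (y : ℝ) (hy : 0 < y) : padeA n y ≤ padeA (n + 1) y := by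
  rw [padeA_eq, padeA_eq, Finset.sum_range_succ _ (n + 1)]
  have h1 : ∑ i ∈ Finset.range (n + 1), padeCoef n i * y ^ i ≤
      ∑ i ∈ Finset.range (n + 1), padeCoef (n + 1) i * y ^ i := by
    apply Finset.sum_le_sum
    intro i hi
    rw [Finset.mem_range] at hi
    exact mul_le_mul_of_nonneg_right (padeCoef_pos_mono i n (by omega)).2 (by positivity)
  have h2 : 0 ≤ padeCoef (n + 1) (n + 1) * y ^ (n + 1) :=
    mul_nonneg (padeCoef_pos_mono (n + 1) (n + 1) le_rfl).1.le (by positivity)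
  linarith

lemma padeA_le (n : ℕ) (y : ℝ) (hy : 0 < y) (hy2 : y ≤ 2) : padeA n y ≤ 6 ^ n := by
  unfold padeA
  have hterm : ∀ i ∈ Finset.range (n + 1), ∀ l ∈ Finset.range (n + 1),
      padeC n i l * y ^ i ≤ ((n.choose i : ℝ) * 2 ^ i) * (n.choose l) := by
    intro i _ l _
    have h1 : |padeC n i l| ≤ (n.choose i : ℝ) * (n.choose l) := by
      unfold padeC
      rw [abs_div, abs_mul, abs_mul, abs_pow, abs_neg, abs_one, one_pow, one_mul,
        abs_of_nonneg (Nat.cast_nonneg _), abs_of_nonneg (Nat.cast_nonneg _)]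
      apply div_le_self (by positivity)
      have h := pade_den_ne i l
      have hz : (6 * ((i : ℤ) - l) + 1 : ℤ) ≠ 0 := by omega
      have : (1 : ℤ) ≤ |6 * ((i : ℤ) - l) + 1| := Int.one_le_abs hz
      exact_mod_cast this
    have h2 : y ^ i ≤ 2 ^ i := pow_le_pow_left₀ hy.le hy2 i
    calc padeC n i l * y ^ i ≤ |padeC n i l| * y ^ i :=
          mul_le_mul_of_nonneg_right (le_abs_self _) (by positivity)
      _ ≤ ((n.choose i : ℝ) * (n.choose l)) * 2 ^ i :=
          mul_le_mul h1 h2 (by positivity) (by positivity)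
      _ = _ := by ring
  refine (Finset.sum_le_sum fun i hi => Finset.sum_le_sum fun l hl => hterm i hi l hl).trans ?_
  rw [← Finset.sum_mul_sum]
  have s1 : ∑ i ∈ Finset.range (n + 1), (n.choose i : ℝ) * 2 ^ i = 3 ^ n := by
    have := add_pow (2 : ℝ) 1 n
    rw [show (2 : ℝ) + 1 = 3 by norm_num] at this
    rw [this]
    refine Finset.sum_congr rfl fun i _ => ?_
    rw [one_pow]; ring
  have s2 : ∑ l ∈ Finset.range (n + 1), (n.choose l : ℝ) = 2 ^ n := by
    exact_mod_cast Nat.sum_range_choose n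
  rw [s1, s2, ← mul_pow]
  norm_num

lemma integral_pow_aux (f : ℝ → ℝ) (a b c : ℝ) (hab : a < b) (hf : ContinuousOn f (Set.Icc a b))
    (hc : c < 1) (hpos : ∀ t ∈ Set.Ioo a b, 0 < f t) (hle : ∀ t ∈ Set.Ioo a b, f t ≤ c) (n : ℕ) :
    0 < ∫ t in a..b, f t ^ n ∧ ∫ t in a..b, f t ^ (n + 1) < ∫ t in a..b, f t ^ n := by
  have hint : ∀ m : ℕ, IntervalIntegrable (fun t => f t ^ m) MeasureTheory.volume a b := by
    intro m
    apply ContinuousOn.intervalIntegrable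
    rw [Set.uIcc_of_le hab.le]
    exact hf.pow m
  constructor
  · exact intervalIntegral.intervalIntegral_pos_of_pos_on (hint n)
      (fun t ht => pow_pos (hpos t ht) n) hab
  · rw [← sub_pos, ← intervalIntegral.integral_sub (hint n) (hint (n + 1))]
    apply intervalIntegral.intervalIntegral_pos_of_pos_on ((hint n).sub (hint (n + 1))) _ hab
    intro t ht
    have h1 := pow_pos (hpos t ht) n
    have h2 := hle t ht
    rw [pow_succ]
    nlinarith

lemma pade_J_bound (x t : ℝ) (hx : 0 < x) (h : (1 ≤ t ∧ t ≤ x) ∨ (x ≤ t ∧ t ≤ 1)) :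
    0 ≤ (t ^ 6 - 1) * ((x / t) ^ 6 - 1) ∧
    (t ^ 6 - 1) * ((x / t) ^ 6 - 1) ≤ (x ^ 6 - 1) ^ 2 := by
  have ht : 0 < t := by rcases h with h | h <;> linarith [h.1, h.2]
  rcases h with ⟨h1, h2⟩ | ⟨h1, h2⟩
  · have a1 : 1 ≤ t ^ 6 := one_le_pow₀ h1
    have a2 : t ^ 6 ≤ x ^ 6 := pow_le_pow_left₀ ht.le h2 6
    have a3 : 1 ≤ (x / t) ^ 6 := one_le_pow₀ ((one_le_div ht).2 h2)
    have a4 : (x / t) ^ 6 ≤ x ^ 6 := pow_le_pow_left₀ (by positivity) (div_le_self hx.le h1) 6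
    constructor <;> nlinarith
  · have a1 : t ^ 6 ≤ 1 := pow_le_one₀ ht.le h2
    have a2 : x ^ 6 ≤ t ^ 6 := pow_le_pow_left₀ hx.le h1 6
    have a3 : (x / t) ^ 6 ≤ 1 := pow_le_one₀ (by positivity) ((div_le_one ht).2 h1)
    have a4 : x ^ 6 ≤ (x / t) ^ 6 := pow_le_pow_left₀ hx.le (by rw [le_div_iff₀ ht]; nlinarith) 6
    constructor <;> nlinarith

lemma pade_J_pos (x t : ℝ) (hx : 0 < x) (h : (1 < t ∧ t < x) ∨ (x < t ∧ t < 1)) :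
    0 < (t ^ 6 - 1) * ((x / t) ^ 6 - 1) := by
  have ht : 0 < t := by rcases h with h | h <;> linarith [h.1, h.2]
  rcases h with ⟨h1, h2⟩ | ⟨h1, h2⟩
  · have a1 : 1 < t ^ 6 := one_lt_pow₀ h1 (by norm_num)
    have a3 : 1 < (x / t) ^ 6 := one_lt_pow₀ ((one_lt_div ht).2 h2) (by norm_num)
    nlinarith
  · have a1 : t ^ 6 < 1 := pow_lt_one₀ ht.le h2 (by norm_num)
    have a3 : (x / t) ^ 6 < 1 := pow_lt_one₀ (by positivity) ((div_lt_one ht).2 h1) (by norm_num)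
    nlinarith

/-- The remainder. -/
noncomputable def padeI (n : ℕ) (x : ℝ) : ℝ := x * padeA n (x ^ 6) - padeB n (x ^ 6)

lemma padeI_abs_le (n : ℕ) (x : ℝ) (hx : 0 < x) :
    |padeI n x| ≤ ((x ^ 6 - 1) ^ 2) ^ n * |x - 1| := by
  unfold padeI
  rw [← pade_integral n x hx]
  have := intervalIntegral.norm_integral_le_of_norm_le_const (a := (1:ℝ)) (b := x)
    (f := fun t => ((t ^ 6 - 1) * ((x / t) ^ 6 - 1)) ^ n) (C := ((x ^ 6 - 1) ^ 2) ^ n) ?_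
  · simpa using this
  · intro t ht
    rw [Set.mem_uIoc] at ht
    have hb := pade_J_bound x t hx (by
      rcases ht with h | h
      · exact Or.inl ⟨h.1.le, h.2⟩
      · exact Or.inr ⟨h.1.le, h.2⟩)
    rw [Real.norm_eq_abs, abs_pow, abs_of_nonneg hb.1]
    exact pow_le_pow_left₀ hb.1 hb.2 n

lemma padeI_lt (n : ℕ) (x : ℝ) (hx : 0 < x) (hx1 : x ≠ 1) (hy : (x ^ 6 - 1) ^ 2 < 1) :
    |padeI (n + 1) x| < |padeI n x| := by
  unfold padeI
  rw [← pade_integral n x hx, ← pade_integral (n + 1) x hx]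
  have hcont : ∀ a b : ℝ, 0 < a →
      ContinuousOn (fun t : ℝ => (t ^ 6 - 1) * ((x / t) ^ 6 - 1)) (Set.Icc a b) := by
    intro a b ha
    have hne : ∀ t ∈ Set.Icc a b, t ≠ 0 := fun t ht => (lt_of_lt_of_le ha ht.1).ne'
    fun_prop (disch := assumption)
  rcases lt_or_gt_of_ne hx1 with h | h
  · have := integral_pow_aux (fun t : ℝ => (t ^ 6 - 1) * ((x / t) ^ 6 - 1)) x 1 _ h
      (hcont x 1 hx) hy (fun t ht => pade_J_pos x t hx (Or.inr ht))
      (fun t ht => (pade_J_bound x t hx (Or.inr ⟨ht.1.le, ht.2.le⟩)).2)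
    rw [intervalIntegral.integral_symm, intervalIntegral.integral_symm x 1, abs_neg, abs_neg,
      abs_of_pos (this n).1, abs_of_pos (this (n + 1)).1]
    exact (this n).2
  · have := integral_pow_aux (fun t : ℝ => (t ^ 6 - 1) * ((x / t) ^ 6 - 1)) 1 x _ h
      (hcont 1 x one_pos) hy (fun t ht => pade_J_pos x t hx (Or.inl ht))
      (fun t ht => (pade_J_bound x t hx (Or.inl ⟨ht.1.le, ht.2.le⟩)).2)
    rw [abs_of_pos (this n).1, abs_of_pos (this (n + 1)).1]
    exact (this n).2

/-- Non-vanishing of one of two consecutive linear forms. -/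
lemma pade_nonvanish (n : ℕ) (x z : ℝ) (hx : 0 < x) (hx1 : x ≠ 1) (hy : (x ^ 6 - 1) ^ 2 < 1) :
    z * padeA n (x ^ 6) - padeB n (x ^ 6) ≠ 0 ∨
    z * padeA (n + 1) (x ^ 6) - padeB (n + 1) (x ^ 6) ≠ 0 := by
  by_contra! hcon
  obtain ⟨h1, h2⟩ := hcon
  have hlt := padeI_lt n x hx hx1 hy
  have hp := padeA_pos n (x ^ 6) (by positivity)
  have hp' := padeA_pos (n + 1) (x ^ 6) (by positivity)
  have hm := padeA_mono n (x ^ 6) (by positivity)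
  have e1 : padeI n x = (x - z) * padeA n (x ^ 6) := by unfold padeI; linarith
  have e2 : padeI (n + 1) x = (x - z) * padeA (n + 1) (x ^ 6) := by unfold padeI; linarith
  rw [e1, e2, abs_mul, abs_mul, abs_of_pos hp, abs_of_pos hp'] at hlt
  have := mul_le_mul_of_nonneg_left hm (abs_nonneg (x - z))
  linarith

/-- Integrality of the scaled linear forms. -/
lemma pade_integral_form (N : ℕ) (α β : ℤ) (y : ℝ) (hβ : β ≠ 0) (hy : y = α / β) (g h : ℤ)
    (z : ℝ) (hh : h ≠ 0) (hz : z = g / h) :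
    ∃ k : ℤ, (Nat.lcmUpto (6 * N + 1) : ℝ) * (β : ℝ) ^ N * h * (z * padeA N y - padeB N y) = k := by
  have hc : ∀ i ∈ Finset.range (N + 1), ∀ l ∈ Finset.range (N + 1), ∃ k : ℤ,
      (Nat.lcmUpto (6 * N + 1) : ℝ) * padeC N i l = k := by
    intro i hi l hl
    rw [Finset.mem_range] at hi hl
    have hd : (6 * ((i : ℤ) - l) + 1) ∣ (Nat.lcmUpto (6 * N + 1) : ℤ) := by
      rw [← Int.natAbs_dvd, Int.natCast_dvd_natCast]
      have hn : 1 ≤ (6 * ((i : ℤ) - l) + 1).natAbs ∧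
          (6 * ((i : ℤ) - l) + 1).natAbs ≤ 6 * N + 1 := by omega
      exact Finset.dvd_lcm (f := id) (Finset.mem_Icc.2 hn)
    obtain ⟨k, hk⟩ := hd
    refine ⟨(-1) ^ (i + l) * (N.choose i) * (N.choose l) * k, ?_⟩
    have hk' : (Nat.lcmUpto (6 * N + 1) : ℝ) = (6 * ((i : ℝ) - l) + 1) * k := by
      exact_mod_cast congrArg (Int.cast : ℤ → ℝ) hk
    have := pade_den_ne i l
    unfold padeC
    rw [hk']
    push_cast
    field_simp
  have hβ' : (β : ℝ) ≠ 0 := by exact_mod_cast hβ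
  have hh' : (h : ℝ) ≠ 0 := by exact_mod_cast hh
  choose! c hc using hc
  have hp : ∀ i ∈ Finset.range (N + 1), (β : ℝ) ^ N * y ^ i = α ^ i * β ^ (N - i) := by
    intro i hi
    rw [Finset.mem_range] at hi
    rw [hy, div_pow, ← Nat.sub_add_cancel (by omega : i ≤ N), pow_add, Nat.add_sub_cancel]
    field_simp
  refine ⟨g * (∑ i ∈ Finset.range (N + 1), ∑ l ∈ Finset.range (N + 1), c i l * (α ^ i * β ^ (N - i)))
    - h * (∑ i ∈ Finset.range (N + 1), ∑ l ∈ Finset.range (N + 1), c i l * (α ^ l * β ^ (N - l))), ?_⟩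
  have eA : (Nat.lcmUpto (6 * N + 1) : ℝ) * (β : ℝ) ^ N * padeA N y =
      ∑ i ∈ Finset.range (N + 1), ∑ l ∈ Finset.range (N + 1), (c i l : ℝ) * (α ^ i * β ^ (N - i)) := by
    unfold padeA
    simp_rw [Finset.mul_sum]
    refine Finset.sum_congr rfl fun i hi => Finset.sum_congr rfl fun l hl => ?_
    rw [← hc i hi l hl, ← hp i hi]; ring
  have eB : (Nat.lcmUpto (6 * N + 1) : ℝ) * (β : ℝ) ^ N * padeB N y =
      ∑ i ∈ Finset.range (N + 1), ∑ l ∈ Finset.range (N + 1), (c i l : ℝ) * (α ^ l * β ^ (N - l)) := by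
    unfold padeB
    simp_rw [Finset.mul_sum]
    refine Finset.sum_congr rfl fun i hi => Finset.sum_congr rfl fun l hl => ?_
    rw [← hc i hi l hl, ← hp l hl]; ring
  push_cast
  rw [← eA, ← eB, hz]
  field_simp

lemma lcmUpto_le : ∃ κ : ℝ, 1 ≤ κ ∧ ∀ N : ℕ, (Nat.lcmUpto (6 * N + 1) : ℝ) ≤ κ ^ (N + 1) := by
  refine ⟨Real.exp ((Real.log 4 + 4) * 6), ?_, ?_⟩
  · rw [Real.one_le_exp_iff]
    have := Real.log_nonneg (by norm_num : (1:ℝ) ≤ 4)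
    positivity
  · intro N
    have h4 := Real.log_nonneg (by norm_num : (1:ℝ) ≤ 4)
    have h := Chebyshev.psi_le_const_mul_self (x := ((6 * N + 1 : ℕ) : ℝ)) (by positivity)
    have hpos : (0 : ℝ) < Nat.lcmUpto (6 * N + 1) := by
      have := Nat.lcmUpto_pos (6 * N + 1)
      exact_mod_cast this
    rw [← Real.exp_log hpos, ← Real.exp_nat_mul, Real.exp_le_exp]
    rw [Chebyshev.psi_eq_log_lcmUpto] at h
    refine h.trans ?_
    push_cast
    nlinarith

lemma abs_sub_one_le_pow_six (w : ℝ) (hw : 0 < w) : |w - 1| ≤ |w ^ 6 - 1| := by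
  have e : w ^ 6 - 1 = (w - 1) * (1 + (w + w ^ 2 + w ^ 3 + w ^ 4 + w ^ 5)) := by ring
  rw [e, abs_mul]
  apply le_mul_of_one_le_right (abs_nonneg _)
  have : 0 < w + w ^ 2 + w ^ 3 + w ^ 4 + w ^ 5 := by positivity
  rw [abs_of_pos (by linarith)]
  linarith

set_option maxHeartbeats 1000000 in
lemma thue_two (a b : ℕ) (ha : 1 ≤ a) (hb : 1 ≤ b) : ∃ C : ℝ, 1 ≤ C ∧ ∀ X0 Y0 X1 Y1 : ℕ,
    2 ≤ X0 → 1 ≤ Y0 → X0 ≤ X1 → 1 ≤ Y1 →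
    (a : ℝ) * X0 ^ 6 - b * Y0 ^ 6 ≠ 0 → |(a : ℝ) * X0 ^ 6 - b * Y0 ^ 6| ≤ X0 →
    |(a : ℝ) * X1 ^ 6 - b * Y1 ^ 6| ≤ X1 → ∀ n : ℕ, ∃ N, (N = n ∨ N = n + 1) ∧
    1 ≤ C ^ (N + 1) * ((X1 : ℝ) / X0 ^ (4 * N + 4) + (X0 : ℝ) ^ (6 * N + 1) / X1 ^ 4) := by
  obtain ⟨κ, hκ, hL⟩ := lcmUpto_le
  have haR : (1 : ℝ) ≤ a := by exact_mod_cast ha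
  have hbR : (1 : ℝ) ≤ b := by exact_mod_cast hb
  refine ⟨12 * a * κ, by nlinarith, ?_⟩
  intro X0 Y0 X1 Y1 hX0 hY0 hX1 hY1 hne h0 h1 n
  have hX0R : (2 : ℝ) ≤ X0 := by exact_mod_cast hX0
  have hY0R : (1 : ℝ) ≤ Y0 := by exact_mod_cast hY0
  have hX1R : (X0 : ℝ) ≤ X1 := by exact_mod_cast hX1
  have hY1R : (1 : ℝ) ≤ Y1 := by exact_mod_cast hY1
  have hX0p : (0 : ℝ) < X0 := by linarith
  have hX1p : (0 : ℝ) < X1 := by linarith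
  have hY0p : (0 : ℝ) < Y0 := by linarith
  have hY1p : (0 : ℝ) < Y1 := by linarith
  have hap : (0 : ℝ) < a := by linarith
  have hbp : (0 : ℝ) < b := by linarith
  have hX05 : (32 : ℝ) ≤ X0 ^ 5 := by
    have := pow_le_pow_left₀ (by norm_num : (0:ℝ) ≤ 2) hX0R 5
    norm_num at this; exact this
  set β : ℝ := b * Y0 ^ 6 with hβ
  have hβp : 0 < β := by positivity
  have hX06 : (X0 : ℝ) ^ 6 = X0 ^ 5 * X0 := by ring
  have ha6 : (X0 : ℝ) ^ 6 ≤ a * X0 ^ 6 := le_mul_of_one_le_left (by positivity) haR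
  obtain ⟨h0a, h0b⟩ := abs_le.1 h0
  have hβlow : (X0 : ℝ) ^ 6 / 2 ≤ β := by nlinarith
  have hβup : β ≤ 2 * a * X0 ^ 6 := by nlinarith
  set y : ℝ := a * X0 ^ 6 / β with hy
  have hyp : 0 < y := by positivity
  have hy1 : |y - 1| ≤ 2 / X0 ^ 5 := by
    have e : y - 1 = (a * X0 ^ 6 - β) / β := by rw [hy]; field_simp
    rw [e, abs_div, abs_of_pos hβp, div_le_div_iff₀ hβp (by positivity)]
    calc |(a : ℝ) * X0 ^ 6 - β| * X0 ^ 5 ≤ X0 * X0 ^ 5 :=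
          mul_le_mul_of_nonneg_right h0 (by positivity)
      _ ≤ 2 * β := by linarith
  have hyn : y ≠ 1 := by
    intro h
    apply hne
    rw [hy, div_eq_one_iff_eq hβp.ne'] at h
    linarith
  have hy16 : |y - 1| ≤ 1 / 16 := by
    refine hy1.trans ?_
    rw [div_le_div_iff₀ (by positivity) (by norm_num)]
    linarith
  obtain ⟨hya, hyb⟩ := abs_le.1 hy16
  obtain ⟨x, hxp, hx6⟩ : ∃ x : ℝ, 0 < x ∧ x ^ 6 = y := by
    refine ⟨y ^ ((1 : ℝ) / 6), by positivity, ?_⟩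
    rw [← Real.rpow_natCast, ← Real.rpow_mul hyp.le]
    norm_num
  have hx1 : x ≠ 1 := by
    rintro rfl
    apply hyn
    rw [← hx6]; norm_num
  have hx2 : x ≤ 2 := by
    have := abs_sub_one_le_pow_six x hxp
    rw [hx6] at this
    have := (abs_le.1 (this.trans hy16)).2
    linarith
  have hsq : (x ^ 6 - 1) ^ 2 < 1 := by
    rw [hx6]; nlinarith
  set z : ℝ := X0 * Y1 / (Y0 * X1) with hz
  have hzp : 0 < z := by positivity
  have hxz : |x - z| ≤ 2 / (X1 : ℝ) ^ 5 := by
    have hw := abs_sub_one_le_pow_six (z / x) (by positivity)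
    have hw6 : (z / x) ^ 6 = b * Y1 ^ 6 / (a * X1 ^ 6) := by
      rw [div_pow, hx6, hz, hy, hβ]
      field_simp
    have hw7 : |(z / x) ^ 6 - 1| ≤ 1 / (X1 : ℝ) ^ 5 := by
      have e : (z / x) ^ 6 - 1 = -((a * X1 ^ 6 - b * Y1 ^ 6) / (a * X1 ^ 6)) := by
        rw [hw6]; field_simp; ring
      rw [e, abs_neg, abs_div, abs_of_pos (by positivity : 0 < (a : ℝ) * X1 ^ 6),
        div_le_div_iff₀ (by positivity) (by positivity)]
      calc |(a : ℝ) * X1 ^ 6 - b * Y1 ^ 6| * X1 ^ 5 ≤ X1 * X1 ^ 5 :=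
            mul_le_mul_of_nonneg_right h1 (by positivity)
        _ = 1 * X1 ^ 6 := by ring
        _ ≤ _ := by
          rw [one_mul, one_mul]
          exact le_mul_of_one_le_left (by positivity) haR
    have e : x - z = -(x * (z / x - 1)) := by field_simp; ring
    rw [e, abs_neg, abs_mul, abs_of_pos hxp]
    calc x * |z / x - 1| ≤ 2 * (1 / X1 ^ 5) :=
          mul_le_mul hx2 (hw.trans hw7) (abs_nonneg _) (by norm_num)
      _ = _ := by ring
  obtain ⟨N, hN, hΛ⟩ : ∃ N, (N = n ∨ N = n + 1) ∧ z * padeA N y - padeB N y ≠ 0 := by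
    rcases pade_nonvanish n x z hxp hx1 hsq with h | h
    · exact ⟨n, Or.inl rfl, by rwa [hx6] at h⟩
    · exact ⟨n + 1, Or.inr rfl, by rwa [hx6] at h⟩
  refine ⟨N, hN, ?_⟩
  obtain ⟨k, hk⟩ := pade_integral_form N (a * X0 ^ 6) (b * Y0 ^ 6) y
    (by positivity) (by push_cast; rw [hy]) (X0 * Y1) (Y0 * X1) z
    (by have : 0 < X1 := by omega
        positivity) (by push_cast; rw [hz])
  push_cast at hk
  rw [← hβ] at hk
  have hLp : (0 : ℝ) < Nat.lcmUpto (6 * N + 1) := by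
    have := Nat.lcmUpto_pos (6 * N + 1)
    exact_mod_cast this
  have hk0 : k ≠ 0 := by
    rintro rfl
    rw [Int.cast_zero] at hk
    have : (Nat.lcmUpto (6 * N + 1) : ℝ) * β ^ N * (Y0 * X1) ≠ 0 := by positivity
    exact (mul_ne_zero this hΛ) hk
  have hk1 : (1 : ℝ) ≤ |(k : ℝ)| := by exact_mod_cast Int.one_le_abs hk0
  rw [← hk, abs_mul, abs_of_pos (by positivity : 0 < (Nat.lcmUpto (6 * N + 1) : ℝ) * β ^ N * (Y0 * X1))] at hk1
  have hY0up : (Y0 : ℝ) ≤ 2 * a * X0 := by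
    by_contra! hcon
    have h1 : (2 * a * X0 : ℝ) ^ 6 < Y0 ^ 6 := pow_lt_pow_left₀ hcon (by positivity) (by norm_num)
    have h2 : (Y0 : ℝ) ^ 6 ≤ β := le_mul_of_one_le_left (by positivity) hbR
    have h3 : (2 * a * X0 : ℝ) ^ 6 = (2 * a) ^ 5 * (2 * a * X0 ^ 6) := by ring
    have h4 : (1 : ℝ) ≤ (2 * a) ^ 5 := one_le_pow₀ (by linarith)
    have h5 : 2 * a * (X0 : ℝ) ^ 6 ≤ (2 * a) ^ 5 * (2 * a * X0 ^ 6) :=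
      le_mul_of_one_le_left (by positivity) h4
    linarith
  have hΛle : |z * padeA N y - padeB N y| ≤ (2 / X0 ^ 5) ^ (2 * N + 1) + 2 / X1 ^ 5 * 6 ^ N := by
    have e : z * padeA N y - padeB N y = padeI N x - (x - z) * padeA N y := by
      unfold padeI; rw [hx6]; ring
    rw [e]
    refine (abs_sub _ _).trans (add_le_add ?_ ?_)
    · refine (padeI_abs_le N x hxp).trans ?_
      have h1 := abs_sub_one_le_pow_six x hxp
      rw [hx6] at h1 ⊢
      calc ((y - 1) ^ 2) ^ N * |x - 1| ≤ (|y - 1| ^ 2) ^ N * |y - 1| := by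
            rw [sq_abs]; exact mul_le_mul_of_nonneg_left h1 (by positivity)
        _ = |y - 1| ^ (2 * N + 1) := by rw [← pow_mul, pow_succ]
        _ ≤ _ := pow_le_pow_left₀ (abs_nonneg _) hy1 _
    · rw [abs_mul, abs_of_pos (padeA_pos N y hyp)]
      exact mul_le_mul hxz (padeA_le N y hyp (by linarith)) (padeA_pos N y hyp).le (by positivity)
  have hbig : 1 ≤ (κ ^ (N + 1) * (2 * a * X0 ^ 6) ^ N * ((2 * a * X0) * X1)) *
      ((2 / X0 ^ 5) ^ (2 * N + 1) + 2 / X1 ^ 5 * 6 ^ N) := by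
    refine hk1.trans ?_
    have hLN := hL N
    gcongr
  refine hbig.trans ?_
  have e1 : (κ ^ (N + 1) * (2 * a * X0 ^ 6) ^ N * ((2 * a * X0) * X1)) *
      ((2 / X0 ^ 5) ^ (2 * N + 1) + 2 / X1 ^ 5 * 6 ^ N) =
      (a * κ) ^ (N + 1) * ((2 ^ (N + 1) * 2 ^ (2 * N + 1)) * (X1 / X0 ^ (4 * N + 4)) +
        (2 ^ (N + 1) * 2 * 6 ^ N) * (X0 ^ (6 * N + 1) / X1 ^ 4)) := by
    have p1 : (X0 : ℝ) ^ (6 * N + 1) = X0 ^ (6 * N) * X0 := pow_succ _ _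
    have p2 : ((X0 : ℝ) ^ 5) ^ (2 * N + 1) = X0 ^ (6 * N) * X0 ^ (4 * N + 4) * X0 := by
      rw [← pow_mul, ← pow_add, ← pow_succ]; congr 1; ring
    have p3 : ((X0 : ℝ) ^ 6) ^ N = X0 ^ (6 * N) := by rw [← pow_mul]
    rw [div_pow, p2, p1, mul_pow, p3, mul_pow, mul_pow, pow_succ κ, pow_succ (a : ℝ), pow_succ (2 : ℝ) N]
    field_simp
  rw [e1]
  have e2 : (12 * (a : ℝ) * κ) ^ (N + 1) = (a * κ) ^ (N + 1) * 12 ^ (N + 1) := by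
    rw [← mul_pow]; congr 1; ring
  rw [e2, mul_assoc ((a * κ) ^ (N + 1)) (12 ^ (N + 1)), mul_add (12 ^ (N + 1) : ℝ)]
  have f1 : (2 : ℝ) ^ (N + 1) * 2 ^ (2 * N + 1) ≤ 12 ^ (N + 1) := by
    have : (2 : ℝ) ^ (2 * N + 1) ≤ 6 ^ (N + 1) := by
      calc (2 : ℝ) ^ (2 * N + 1) ≤ 2 ^ (2 * (N + 1)) := pow_le_pow_right₀ (by norm_num) (by omega)
        _ = 4 ^ (N + 1) := by rw [pow_mul]; norm_num
        _ ≤ 6 ^ (N + 1) := pow_le_pow_left₀ (by norm_num) (by norm_num) _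
    calc (2 : ℝ) ^ (N + 1) * 2 ^ (2 * N + 1) ≤ 2 ^ (N + 1) * 6 ^ (N + 1) := by gcongr
      _ = 12 ^ (N + 1) := by rw [← mul_pow]; norm_num
  have f2 : (2 : ℝ) ^ (N + 1) * 2 * 6 ^ N ≤ 12 ^ (N + 1) := by
    have : (12 : ℝ) ^ (N + 1) = 2 ^ (N + 1) * 6 ^ (N + 1) := by rw [← mul_pow]; norm_num
    rw [this, pow_succ (6 : ℝ), mul_assoc, mul_comm (6 ^ N : ℝ) 6]
    gcongr
    norm_num
  gcongr

/-- A finiteness theorem of Thue type. -/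
lemma thue_finite (a b : ℕ) (ha : 1 ≤ a) (hb : 1 ≤ b) : ∃ M : ℕ, ∀ X Y : ℕ, 1 ≤ Y →
    (a : ℝ) * X ^ 6 - b * Y ^ 6 ≠ 0 → |(a : ℝ) * X ^ 6 - b * Y ^ 6| ≤ X → X ≤ M := by
  obtain ⟨C, hC, hT⟩ := thue_two a b ha hb
  by_cases hall : ∀ X Y : ℕ, 1 ≤ Y → (a : ℝ) * X ^ 6 - b * Y ^ 6 ≠ 0 →
      |(a : ℝ) * X ^ 6 - b * Y ^ 6| ≤ X → (X : ℝ) ≤ 2 * C ^ 2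
  · refine ⟨⌊2 * C ^ 2⌋₊, fun X Y h1 h2 h3 => Nat.le_floor (hall X Y h1 h2 h3)⟩
  push Not at hall
  obtain ⟨X0, Y0, hY0, hne, h0, hbig⟩ := hall
  refine ⟨X0 ^ 16, fun X1 Y1 hY1 _ h1 => ?_⟩
  by_contra! hX1
  have hC2 : 1 ≤ C ^ 2 := one_le_pow₀ hC
  have hX0 : 2 ≤ X0 := by
    have : (2 : ℝ) ≤ X0 := by linarith
    exact_mod_cast this
  have hX0R : (2 : ℝ) ≤ X0 := by linarith
  have hX01 : X0 ≤ X1 := (Nat.le_self_pow (by norm_num) X0).trans hX1.le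
  have hbase : 1 < X0 ^ 2 := by nlinarith
  set n := Nat.log (X0 ^ 2) X1 with hn
  have hlow : (X0 ^ 2) ^ n ≤ X1 := Nat.pow_log_le_self _ (by omega)
  have hup : X1 < (X0 ^ 2) ^ (n + 1) := Nat.lt_pow_succ_log_self hbase _
  have hn8 : 8 ≤ n := by
    apply Nat.le_log_of_pow_le hbase
    rw [← pow_mul]; exact hX1.le
  obtain ⟨N, hN, hle⟩ := hT X0 Y0 X1 Y1 hX0 hY0 hX01 hY1 hne h0 h1 n
  have hX0p : (0 : ℝ) < X0 := by linarith
  have hX1p : (0 : ℝ) < X1 := by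
    have : 0 < X1 := by omega
    exact_mod_cast this
  have hlowR : (X0 : ℝ) ^ (2 * n) ≤ X1 := by rw [pow_mul]; exact_mod_cast hlow
  have hupR : (X1 : ℝ) ≤ X0 ^ (2 * (n + 1)) := by rw [pow_mul]; exact_mod_cast hup.le
  have hNn : n ≤ N ∧ N ≤ n + 1 := by omega
  have g1 : (X1 : ℝ) / X0 ^ (4 * N + 4) ≤ 1 / X0 ^ (n + 1) := by
    rw [div_le_div_iff₀ (by positivity) (by positivity)]
    calc (X1 : ℝ) * X0 ^ (n + 1) ≤ X0 ^ (2 * (n + 1)) * X0 ^ (n + 1) := by gcongr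
      _ = X0 ^ (3 * n + 3) := by rw [← pow_add]; congr 1; ring
      _ ≤ X0 ^ (4 * N + 4) := pow_le_pow_right₀ (by linarith) (by omega)
      _ = _ := by rw [one_mul]
  have g2 : (X0 : ℝ) ^ (6 * N + 1) / X1 ^ 4 ≤ 1 / X0 ^ (n + 1) := by
    rw [div_le_div_iff₀ (by positivity) (by positivity), ← pow_add, one_mul]
    calc (X0 : ℝ) ^ (6 * N + 1 + (n + 1)) ≤ X0 ^ (2 * n * 4) :=
          pow_le_pow_right₀ (by linarith) (by omega)
      _ = (X0 ^ (2 * n)) ^ 4 := by rw [pow_mul]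
      _ ≤ X1 ^ 4 := by gcongr
  have g3 : C ^ (N + 1) ≤ C ^ (2 * (n + 1)) := pow_le_pow_right₀ hC (by omega)
  have g4 : 1 ≤ C ^ (2 * (n + 1)) * (1 / X0 ^ (n + 1) + 1 / X0 ^ (n + 1)) := by
    refine hle.trans ?_
    gcongr
  have g5 : (2 * C ^ 2) ^ (n + 1) < X0 ^ (n + 1) := pow_lt_pow_left₀ hbig (by positivity) (by omega)
  have g6 : (2 : ℝ) ≤ 2 ^ (n + 1) := by
    calc (2 : ℝ) = 2 ^ 1 := by norm_num
      _ ≤ 2 ^ (n + 1) := pow_le_pow_right₀ (by norm_num) (by omega)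
  rw [mul_pow, ← pow_mul] at g5
  have g7 : C ^ (2 * (n + 1)) * (1 / (X0 : ℝ) ^ (n + 1) + 1 / X0 ^ (n + 1)) =
      2 * C ^ (2 * (n + 1)) / X0 ^ (n + 1) := by ring
  rw [g7, le_div_iff₀ (by positivity), one_mul] at g4
  have : 2 * C ^ (2 * (n + 1)) ≤ 2 ^ (n + 1) * C ^ (2 * (n + 1)) := by gcongr
  linarith

lemma padicValNat_le_of_dvd_aux (p a b : ℕ) [Fact p.Prime] (hb : b ≠ 0) (h : a ∣ b) :
    padicValNat p a ≤ padicValNat p b :=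
  (padicValNat_dvd_iff_le hb).1 (pow_padicValNat_dvd.trans h)

lemma val_pow_sub_one (p s : ℕ) (hp : p.Prime) (hs : 2 ≤ s) :
    ∃ C : ℕ, ∀ n, 1 ≤ n → padicValNat p (s ^ n - 1) ≤ C + Nat.log 2 n := by
  have : Fact p.Prime := ⟨hp⟩
  have hpow : ∀ m, 1 ≤ m → 2 ≤ s ^ m := fun m hm => hs.trans (Nat.le_self_pow (by omega) s)
  by_cases hps : p ∣ s
  · refine ⟨0, fun n hn => ?_⟩
    have h0 : padicValNat p (s ^ n - 1) = 0 := by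
      apply padicValNat.eq_zero_of_not_dvd
      intro hd
      have h1 : p ∣ s ^ n := dvd_pow hps (by omega)
      have h2 : p ∣ 1 := by
        have := Nat.dvd_sub h1 hd
        rwa [Nat.sub_sub_self (by have := hpow n hn; omega)] at this
      exact hp.one_lt.ne' (Nat.dvd_one.1 h2)
    omega
  rcases hp.eq_two_or_odd' with rfl | hodd
  · refine ⟨padicValNat 2 (s + 1) + padicValNat 2 (s - 1) + 1, fun n hn => ?_⟩
    have h1 := padicValNat.pow_two_sub_one (x := s) (n := 2 * n) (by omega) hps (by omega)
      (even_two_mul n)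
    have h2 : padicValNat 2 (s ^ n - 1) ≤ padicValNat 2 (s ^ (2 * n) - 1) :=
      padicValNat_le_of_dvd_aux 2 _ _ (by have := hpow (2 * n) (by omega); omega)
        (Nat.pow_sub_one_dvd_pow_sub_one _ (Dvd.intro_left _ rfl))
    have h3 : padicValNat 2 (2 * n) = 1 + padicValNat 2 n := by
      rw [padicValNat.mul (by norm_num) (by omega), padicValNat.self (by norm_num)]
    have h4 := padicValNat_le_nat_log (p := 2) n
    omega
  · have hp1 : 1 ≤ p - 1 := by have := hp.two_le; omega
    refine ⟨padicValNat p (s ^ (p - 1) - 1), fun n hn => ?_⟩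
    have hx := hpow (p - 1) hp1
    have hd : p ∣ s ^ (p - 1) - 1 := by
      have hc : s.Coprime p := ((Nat.Prime.coprime_iff_not_dvd hp).2 hps).symm
      have := Nat.ModEq.pow_totient hc
      rw [Nat.totient_prime hp] at this
      exact (Nat.modEq_iff_dvd' (by omega)).1 this.symm
    have h1 := padicValNat.pow_sub_pow (p := p) (x := s ^ (p - 1)) (y := 1) hodd (by omega) hd
      (fun h => hps (hp.dvd_of_dvd_pow h)) (n := n) (by omega)
    rw [one_pow, ← pow_mul] at h1
    have h2 : padicValNat p (s ^ n - 1) ≤ padicValNat p (s ^ ((p - 1) * n) - 1) :=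
      padicValNat_le_of_dvd_aux p _ _
        (by have := hpow ((p - 1) * n) (Nat.mul_pos hp1 hn); omega)
        (Nat.pow_sub_one_dvd_pow_sub_one _ (Dvd.intro_left _ rfl))
    have h4 := padicValNat_le_nat_log (p := p) n
    have h5 := Nat.log_anti_left (n := n) one_lt_two hp.two_le
    omega

lemma exists_primes (r s : ℕ) (hr : 2 ≤ r) (hs : 2 ≤ s) (hind : MultIndep r s) :
    ∃ p q : ℕ, p.Prime ∧ q.Prime ∧
      padicValNat p r * padicValNat q s ≠ padicValNat q r * padicValNat p s := by
  by_contra! hcon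
  obtain ⟨p, hp, hpr⟩ := Nat.exists_prime_and_dvd (by omega : r ≠ 1)
  have : Fact p.Prime := ⟨hp⟩
  have h1 : r ^ padicValNat p s = s ^ padicValNat p r := by
    apply Nat.eq_of_factorization_eq (by positivity) (by positivity)
    intro q
    by_cases hq : q.Prime
    · have : Fact q.Prime := ⟨hq⟩
      rw [Nat.factorization_def _ hq, Nat.factorization_def _ hq, padicValNat.pow, padicValNat.pow]
      rw [hcon p q hp hq, mul_comm]
    · rw [Nat.factorization_eq_zero_of_not_prime _ hq, Nat.factorization_eq_zero_of_not_prime _ hq]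
  have h2 := (hind _ _ h1).2
  have h3 := one_le_padicValNat_of_dvd (by omega) hpr
  omega

lemma val_eq_bound (r s A B : ℕ) (hr : 2 ≤ r) (hs : 2 ≤ s) (hA : 1 ≤ A) (hB : 1 ≤ B) (p : ℕ)
    (hp : p.Prime) : ∃ D : ℕ, ∀ u v u' v' : ℕ, 1 ≤ v → 1 ≤ v' →
    A * (r ^ u * (r ^ v - 1)) = B * (s ^ u' * (s ^ v' - 1)) →
    |(u : ℤ) * padicValNat p r - u' * padicValNat p s| ≤
      (D + Nat.log 2 v + Nat.log 2 v' : ℕ) := by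
  have : Fact p.Prime := ⟨hp⟩
  obtain ⟨C1, h1⟩ := val_pow_sub_one p r hp hr
  obtain ⟨C2, h2⟩ := val_pow_sub_one p s hp hs
  refine ⟨padicValNat p A + padicValNat p B + C1 + C2, fun u v u' v' hv hv' heq => ?_⟩
  have e1 : r ^ v - 1 ≠ 0 := by
    have := hr.trans (Nat.le_self_pow (by omega : v ≠ 0) r); omega
  have e2 : s ^ v' - 1 ≠ 0 := by
    have := hs.trans (Nat.le_self_pow (by omega : v' ≠ 0) s); omega
  have e3 : r ^ u ≠ 0 := by positivity
  have e4 : s ^ u' ≠ 0 := by positivity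
  have h := congrArg (padicValNat p) heq
  rw [padicValNat.mul (by omega) (mul_ne_zero e3 e1), padicValNat.mul e3 e1,
    padicValNat.mul (by omega) (mul_ne_zero e4 e2), padicValNat.mul e4 e2, padicValNat.pow,
    padicValNat.pow] at h
  have g1 := h1 v hv
  have g2 := h2 v' hv'
  revert h g1 g2
  generalize padicValNat p A = a1
  generalize padicValNat p B = a2
  generalize padicValNat p (r ^ v - 1) = a3
  generalize padicValNat p (s ^ v' - 1) = a4
  generalize padicValNat p r = a5
  generalize padicValNat p s = a6
  generalize Nat.log 2 v = a7
  generalize Nat.log 2 v' = a8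
  intro h g1 g2
  zify at h g1 g2
  rw [abs_le]
  push_cast
  constructor <;> linarith

lemma cramer_aux (a b c d u w E : ℤ) (hb : 0 ≤ b) (hd : 0 ≤ d)
    (hu : 0 ≤ u) (hdet : a * d ≠ c * b) (h1 : |u * a - w * b| ≤ E) (h2 : |u * c - w * d| ≤ E) :
    u ≤ E * (b + d) := by
  have e : u * (a * d - c * b) = (u * a - w * b) * d - (u * c - w * d) * b := by ring
  have h3 : 1 ≤ |a * d - c * b| := Int.one_le_abs (sub_ne_zero.2 hdet)
  calc u = |u| * 1 := by rw [abs_of_nonneg hu, mul_one]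
    _ ≤ |u| * |a * d - c * b| := mul_le_mul_of_nonneg_left h3 (abs_nonneg _)
    _ = |(u * a - w * b) * d - (u * c - w * d) * b| := by rw [← abs_mul, e]
    _ ≤ |(u * a - w * b) * d| + |(u * c - w * d) * b| := abs_sub _ _
    _ = |u * a - w * b| * d + |u * c - w * d| * b := by
      rw [abs_mul, abs_mul, abs_of_nonneg hd, abs_of_nonneg hb]
    _ ≤ E * d + E * b := by gcongr
    _ = _ := by ring

lemma u_bound (r s A B : ℕ) (hr : 2 ≤ r) (hs : 2 ≤ s) (hind : MultIndep r s)
    (hA : 1 ≤ A) (hB : 1 ≤ B) : ∃ D : ℕ, ∀ u v u' v' : ℕ, 1 ≤ v → 1 ≤ v' →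
    A * (r ^ u * (r ^ v - 1)) = B * (s ^ u' * (s ^ v' - 1)) →
    u ≤ D * (1 + Nat.log 2 v + Nat.log 2 v') ∧ u' ≤ D * (1 + Nat.log 2 v + Nat.log 2 v') := by
  obtain ⟨p, q, hp, hq, hne⟩ := exists_primes r s hr hs hind
  obtain ⟨D1, h1⟩ := val_eq_bound r s A B hr hs hA hB p hp
  obtain ⟨D2, h2⟩ := val_eq_bound r s A B hr hs hA hB q hq
  set a := padicValNat p r
  set b := padicValNat p s
  set c := padicValNat q r
  set d := padicValNat q s
  refine ⟨(D1 + D2 + 1) * (a + b + c + d), fun u v u' v' hv hv' heq => ?_⟩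
  have g1 := h1 u v u' v' hv hv' heq
  have g2 := h2 u v u' v' hv hv' heq
  set W := Nat.log 2 v + Nat.log 2 v' with hW
  set E := (D1 + D2 + 1) * (1 + W) with hE
  have k1 : D1 + Nat.log 2 v + Nat.log 2 v' ≤ E := by rw [hE, add_assoc, ← hW]; nlinarith
  have k2 : D2 + Nat.log 2 v + Nat.log 2 v' ≤ E := by rw [hE, add_assoc, ← hW]; nlinarith
  have f1 : |(u : ℤ) * a - u' * b| ≤ (E : ℤ) := g1.trans (by exact_mod_cast k1)
  have f2 : |(u : ℤ) * c - u' * d| ≤ (E : ℤ) := g2.trans (by exact_mod_cast k2)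
  have r1 := cramer_aux a b c d u u' E (by positivity) (by positivity) (by positivity) (by exact_mod_cast hne) f1 f2
  have r2 := cramer_aux b a d c u' u E (by positivity) (by positivity) (by positivity) (by
      intro h
      apply hne
      have h' : b * c = d * a := by exact_mod_cast h
      rw [mul_comm a d, mul_comm c b, h']) (by rwa [abs_sub_comm]) (by rwa [abs_sub_comm])
  have r1' : u ≤ E * (b + d) := by exact_mod_cast r1
  have r2' : u' ≤ E * (a + c) := by exact_mod_cast r2
  have e : (D1 + D2 + 1) * (a + b + c + d) * (1 + Nat.log 2 v + Nat.log 2 v') =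
      E * (a + b + c + d) := by rw [hE, hW]; ring
  rw [e]
  constructor
  · exact r1'.trans (Nat.mul_le_mul_left _ (by omega))
  · exact r2'.trans (Nat.mul_le_mul_left _ (by omega))

lemma log_small (K : ℕ) : ∃ M : ℕ, ∀ m, M ≤ m → K * (1 + Nat.log 2 m) ≤ m := by
  refine ⟨2 ^ (4 * K), fun m hm => ?_⟩
  have hm0 : m ≠ 0 := by have : 0 < 2 ^ (4 * K) := by positivity
                         omega
  set k := Nat.log 2 m with hk
  have hk4 : 4 * K ≤ k := Nat.le_log_of_pow_le one_lt_two hm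
  have hkm : 2 ^ k ≤ m := Nat.pow_log_le_self 2 hm0
  set j := k / 2 with hj
  have h1 : 2 ^ j * 2 ^ j ≤ 2 ^ k := by
    rw [← pow_add]; exact Nat.pow_le_pow_right (by norm_num) (by omega)
  have h2 : j < 2 ^ j := Nat.lt_two_pow_self
  have h3 : 2 * K ≤ j := by omega
  have h4 : 1 + k ≤ 2 * (j + 1) := by omega
  calc K * (1 + k) ≤ K * (2 * (j + 1)) := Nat.mul_le_mul_left _ h4
    _ = (2 * K) * (j + 1) := by ring
    _ ≤ 2 ^ j * 2 ^ j := Nat.mul_le_mul (by omega) h2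
    _ ≤ m := h1.trans hkm

lemma le_pow_self_aux (a r : ℕ) (hr : 2 ≤ r) : a ≤ r ^ a :=
  (Nat.lt_pow_self (by omega)).le

set_option maxHeartbeats 1000000 in
/-- Theorem N. -/
lemma bounded_solutions (r s A B : ℕ) (hr : 2 ≤ r) (hs : 2 ≤ s) (hind : MultIndep r s)
    (hA : 1 ≤ A) (hB : 1 ≤ B) : ∃ M : ℕ, ∀ u v u' v' : ℕ, 1 ≤ v → 1 ≤ v' →
    A * (r ^ u * (r ^ v - 1)) = B * (s ^ u' * (s ^ v' - 1)) → u + v ≤ M := by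
  obtain ⟨D, hD⟩ := u_bound r s A B hr hs hind hA hB
  have hth : ∀ j l : ℕ, ∃ M : ℕ, ∀ X Y : ℕ, 1 ≤ Y →
    ((A * r ^ j : ℕ) : ℝ) * X ^ 6 - (B * s ^ l : ℕ) * Y ^ 6 ≠ 0 →
    |((A * r ^ j : ℕ) : ℝ) * X ^ 6 - (B * s ^ l : ℕ) * Y ^ 6| ≤ X → X ≤ M := fun j l =>
      thue_finite (A * r ^ j) (B * s ^ l) (Nat.mul_pos hA (by positivity))
        (Nat.mul_pos hB (by positivity))
  choose Mf hMf using hth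
  set Ms := ∑ j ∈ Finset.range 6, ∑ l ∈ Finset.range 6, Mf j l with hMs
  have hMle : ∀ j l, j < 6 → l < 6 → Mf j l ≤ Ms := by
    intro j l hj hl
    calc Mf j l ≤ ∑ l ∈ Finset.range 6, Mf j l :=
          Finset.single_le_sum (f := fun l => Mf j l) (fun _ _ => Nat.zero_le _)
            (Finset.mem_range.2 hl)
      _ ≤ Ms := Finset.single_le_sum (f := fun j => ∑ l ∈ Finset.range 6, Mf j l)
            (fun _ _ => Nat.zero_le _) (Finset.mem_range.2 hj)
  obtain ⟨M1, hM1⟩ := log_small (12 * (1 + s) * D * (A + r + 3))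
  refine ⟨M1 + 12 * (A + B) + 12 + (6 * Ms + 6), fun u v u' v' hv hv' heq => ?_⟩
  by_contra! hbig
  set m := u + v with hm
  set m' := u' + v' with hm'
  obtain ⟨hu, hu'⟩ := hD u v u' v' hv hv' heq
  have hm1 : 1 ≤ m := by omega
  have hrv : 2 ≤ r ^ v := hr.trans (Nat.le_self_pow (by omega) r)
  have hsv : 2 ≤ s ^ v' := hs.trans (Nat.le_self_pow (by omega) s)
  -- size bound for the second exponent
  have hv'le : v' ≤ A + r * m + 1 := by
    by_contra! hcon
    have h1 : 2 ^ (A + r * m + 1) ≤ s ^ v' - 1 := by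
      have : 2 ^ (A + r * m + 1) * 2 ≤ s ^ v' := by
        rw [← pow_succ]
        exact (Nat.pow_le_pow_right (by norm_num) hcon).trans (Nat.pow_le_pow_left hs _)
      have h0 : 1 ≤ 2 ^ (A + r * m + 1) := Nat.one_le_two_pow
      omega
    have h2 : s ^ v' - 1 ≤ B * (s ^ u' * (s ^ v' - 1)) := by
      rw [← mul_assoc]
      exact Nat.le_mul_of_pos_left _ (Nat.mul_pos hB (by positivity))
    have h3 : A * (r ^ u * (r ^ v - 1)) ≤ A * r ^ m := by
      apply Nat.mul_le_mul_left
      rw [hm, pow_add]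
      exact Nat.mul_le_mul_left _ (Nat.sub_le _ _)
    have h4 : A * r ^ m ≤ 2 ^ (A + r * m) := by
      rw [pow_add 2, pow_mul 2]
      exact Nat.mul_le_mul (le_pow_self_aux A 2 le_rfl)
        (Nat.pow_le_pow_left (le_pow_self_aux r 2 le_rfl) m)
    have h5 : 2 ^ (A + r * m) < 2 ^ (A + r * m + 1) := Nat.pow_lt_pow_right (by norm_num) (by omega)
    omega
  have hlogv : Nat.log 2 v ≤ Nat.log 2 m := Nat.log_mono_right (by omega)
  have hlogv' : Nat.log 2 v' ≤ (A + r + 1) + Nat.log 2 m := by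
    have h1 : v' ≤ m * 2 ^ (A + r + 1) := by
      have : A + r + 1 ≤ 2 ^ (A + r + 1) := le_pow_self_aux _ 2 le_rfl
      have h6 : m * (A + r + 1) ≤ m * 2 ^ (A + r + 1) := Nat.mul_le_mul_left _ this
      have h7 : A ≤ m * A := Nat.le_mul_of_pos_left _ hm1
      nlinarith
    have h2 : Nat.log 2 (m * 2 ^ (A + r + 1)) = Nat.log 2 m + (A + r + 1) := by
      generalize A + r + 1 = k
      induction k with
      | zero => simp
      | succ k ih =>
        rw [pow_succ, ← mul_assoc, Nat.log_mul_base (by norm_num) (by positivity), ih]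
        ring
    have h3 := Nat.log_mono_right (b := 2) h1
    omega
  have hW : 1 + Nat.log 2 v + Nat.log 2 v' ≤ (A + r + 3) * (1 + Nat.log 2 m) := by nlinarith
  have hK := hM1 m (by omega)
  have hU : 12 * (1 + s) * (D * (1 + Nat.log 2 v + Nat.log 2 v')) ≤ m := by
    refine le_trans ?_ hK
    calc 12 * (1 + s) * (D * (1 + Nat.log 2 v + Nat.log 2 v'))
        ≤ 12 * (1 + s) * (D * ((A + r + 3) * (1 + Nat.log 2 m))) := by gcongr
      _ = _ := by ring
  set Z := D * (1 + Nat.log 2 v + Nat.log 2 v') with hZ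
  have hsZ : 12 * u + 12 * (s * u') ≤ m := by
    have : s * u' ≤ s * Z := Nat.mul_le_mul_left _ hu'
    nlinarith
  have hAu : A + u ≤ m / 6 := by omega
  have hBu : B + s * u' ≤ m / 6 := by omega
  have hAr : A * r ^ u ≤ r ^ (m / 6) := by
    calc A * r ^ u ≤ r ^ A * r ^ u := Nat.mul_le_mul_right _ (le_pow_self_aux A r hr)
      _ = r ^ (A + u) := by rw [pow_add]
      _ ≤ _ := Nat.pow_le_pow_right (by omega) hAu
  have hBs : B * s ^ u' ≤ r ^ (m / 6) := by
    calc B * s ^ u' ≤ r ^ B * (r ^ s) ^ u' :=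
          Nat.mul_le_mul (le_pow_self_aux B r hr) (Nat.pow_le_pow_left (le_pow_self_aux s r hr) _)
      _ = r ^ (B + s * u') := by rw [pow_add, pow_mul]
      _ ≤ _ := Nat.pow_le_pow_right (by omega) hBu
  -- the key identity
  have hkey : (A : ℝ) * r ^ m - B * s ^ m' = A * r ^ u - B * s ^ u' := by
    have h := congrArg (Nat.cast : ℕ → ℝ) heq
    push_cast [Nat.cast_sub (by omega : 1 ≤ r ^ v), Nat.cast_sub (by omega : 1 ≤ s ^ v')] at h
    rw [hm, hm', pow_add, pow_add]
    linarith
  have hne : (A : ℝ) * r ^ u - B * s ^ u' ≠ 0 := by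
    intro h0
    have h1 : A * r ^ u = B * s ^ u' := by
      have : (A : ℝ) * r ^ u = B * s ^ u' := by linarith
      exact_mod_cast this
    rw [← mul_assoc, ← mul_assoc, h1] at heq
    have h2 := Nat.eq_of_mul_eq_mul_left (Nat.mul_pos hB (by positivity)) heq
    have h3 : r ^ v = s ^ v' := by omega
    have := (hind v v' h3).1
    omega
  have e1 : ((A * r ^ (m % 6) : ℕ) : ℝ) * ((r ^ (m / 6) : ℕ) : ℝ) ^ 6 = A * r ^ m := by
    push_cast
    rw [← pow_mul, mul_assoc, ← pow_add]
    congr 2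
    omega
  have e2 : ((B * s ^ (m' % 6) : ℕ) : ℝ) * ((s ^ (m' / 6) : ℕ) : ℝ) ^ 6 = B * s ^ m' := by
    push_cast
    rw [← pow_mul, mul_assoc, ← pow_add]
    congr 2
    omega
  have hfin := hMf (m % 6) (m' % 6) (r ^ (m / 6)) (s ^ (m' / 6)) (Nat.one_le_pow _ _ (by omega))
    (by rw [e1, e2, hkey]; exact hne)
    (by
      rw [e1, e2, hkey]
      have hAr' : (A : ℝ) * r ^ u ≤ ((r ^ (m / 6) : ℕ) : ℝ) := by exact_mod_cast hAr
      have hBs' : (B : ℝ) * s ^ u' ≤ ((r ^ (m / 6) : ℕ) : ℝ) := by exact_mod_cast hBs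
      have p1 : (0 : ℝ) ≤ A * r ^ u := by positivity
      have p2 : (0 : ℝ) ≤ B * s ^ u' := by positivity
      rw [abs_le]
      constructor <;> linarith)
  have h1 := hMle (m % 6) (m' % 6) (Nat.mod_lt _ (by norm_num)) (Nat.mod_lt _ (by norm_num))
  have h2 := le_pow_self_aux (m / 6) r hr
  omega

lemma dist_lower (ξ : ℝ) (hξ : Irrational ξ) (q0 : ℕ) : ∃ ε : ℝ, 0 < ε ∧
    ∀ q : ℕ, 1 ≤ q → q < q0 → ∀ p : ℤ, ε ≤ |q * ξ - p| := by
  induction q0 with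
  | zero => exact ⟨1, one_pos, fun q _ h => absurd h (by omega)⟩
  | succ k ih =>
    obtain ⟨ε, hε, h⟩ := ih
    rcases Nat.eq_zero_or_pos k with rfl | hk
    · exact ⟨1, one_pos, fun q h1 h2 => absurd h2 (by omega)⟩
    · refine ⟨min ε |k * ξ - round (k * ξ)|, lt_min hε ?_, ?_⟩
      · rw [abs_pos, sub_ne_zero]
        exact (hξ.natCast_mul (by omega)).ne_int _
      · intro q h1 h2 p
        rcases Nat.lt_succ_iff_lt_or_eq.1 h2 with h3 | rfl
        · exact (min_le_left _ _).trans (h q h1 h3 p)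
        · exact (min_le_right _ _).trans (round_le _ _)

lemma good_approx (r : ℕ) (hr : 2 ≤ r) (ξ : ℝ) (hξ : Irrational ξ)
    (hrep : ∀ n, 1 ≤ n → ∃ u v, 1 ≤ v ∧ u + v ≤ n + 1 ∧
      ∀ i < n, bdigit r ξ (u + i) = bdigit r ξ (u + v + i)) (H : ℝ) (q0 : ℕ) :
    ∃ (q : ℕ) (p : ℤ), 1 ≤ q ∧ q0 ≤ q ∧ IsCoprime (q : ℤ) p ∧ H * (q * |q * ξ - p|) ≤ 1 := by
  obtain ⟨ε, hε, hlow⟩ := dist_lower ξ hξ q0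
  have hrR : (2 : ℝ) ≤ r := by exact_mod_cast hr
  obtain ⟨t, ht⟩ := pow_unbounded_of_one_lt (max H (1 / ε)) (by linarith : (1 : ℝ) < r)
  have htH : H < (r : ℝ) ^ t := (le_max_left _ _).trans_lt ht
  have hte : 1 / ε < (r : ℝ) ^ t := (le_max_right _ _).trans_lt ht
  obtain ⟨n, u, v, hv, hn, hper⟩ := exists_good_rep (bdigit r ξ)
    (fun g hg => bdigit_not_periodic r hr ξ hξ g hg) hrep t
  obtain ⟨P, hP⟩ := bdigit_approx r hr ξ n u v hper
  have hrv : 2 ≤ r ^ v := hr.trans (Nat.le_self_pow (by omega) r)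
  set Q : ℕ := r ^ u * (r ^ v - 1) with hQ
  have hQ1 : 1 ≤ Q := Nat.mul_pos (by positivity) (by omega)
  have hQR : (Q : ℝ) = (r : ℝ) ^ u * ((r : ℝ) ^ v - 1) := by
    rw [hQ]; push_cast [Nat.cast_sub (by omega : 1 ≤ r ^ v)]; ring
  rw [← hQR] at hP
  have hQle : (Q : ℝ) * r ^ t ≤ r ^ n := by
    have h1 : Q ≤ r ^ (u + v) := by
      rw [hQ, pow_add]; exact Nat.mul_le_mul_left _ (Nat.sub_le _ _)
    have h2 : Q * r ^ t ≤ r ^ n := by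
      calc Q * r ^ t ≤ r ^ (u + v) * r ^ t := Nat.mul_le_mul_right _ h1
        _ = r ^ (u + v + t) := by rw [pow_add _ (u + v)]
        _ ≤ _ := Nat.pow_le_pow_right (by omega) hn
    exact_mod_cast h2
  have hmain : (Q : ℝ) * |Q * ξ - P| * r ^ t < 1 := by
    calc (Q : ℝ) * |Q * ξ - P| * r ^ t = |Q * ξ - P| * (Q * r ^ t) := by ring
      _ ≤ |Q * ξ - P| * r ^ n := mul_le_mul_of_nonneg_left hQle (abs_nonneg _)
      _ < 1 := hP
  obtain ⟨g, q, p, hg, hcop, eQ, eP⟩ : ∃ (g q : ℕ) (p : ℤ), 1 ≤ g ∧ IsCoprime (q : ℤ) p ∧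
      Q = g * q ∧ P = g * p := by
    have hgpos : 0 < Int.gcd (Q : ℤ) P := Int.gcd_pos_of_ne_zero_left _ (by omega)
    obtain ⟨a, ha⟩ := Int.gcd_dvd_left (Q : ℤ) P
    obtain ⟨b, hb⟩ := Int.gcd_dvd_right (Q : ℤ) P
    set g := Int.gcd (Q : ℤ) P with hgdef
    have ha0 : 0 ≤ a := by
      by_contra! hneg
      have : (g : ℤ) * a < 0 := mul_neg_of_pos_of_neg (by exact_mod_cast hgpos) hneg
      omega
    obtain ⟨q, rfl⟩ := Int.eq_ofNat_of_zero_le ha0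
    refine ⟨g, q, b, hgpos, ?_, by exact_mod_cast ha, hb⟩
    rw [Int.isCoprime_iff_gcd_eq_one]
    have h1 : Int.gcd (g * (q : ℤ)) (g * b) = g * Int.gcd q b := by
      rw [Int.gcd_mul_left]; simp
    rw [← ha, ← hb, ← hgdef] at h1
    exact Nat.eq_of_mul_eq_mul_left hgpos (by rw [← h1, mul_one])
  have hq1 : 1 ≤ q := by
    rcases Nat.eq_zero_or_pos q with rfl | h
    · omega
    · exact h
  have hgR : (1 : ℝ) ≤ g := by exact_mod_cast hg
  have hqR : (1 : ℝ) ≤ q := by exact_mod_cast hq1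
  have hred : (q : ℝ) * |q * ξ - p| ≤ Q * |Q * ξ - P| := by
    have e : (Q : ℝ) * |Q * ξ - P| = (g * g) * (q * |q * ξ - p|) := by
      rw [eQ, eP]
      push_cast
      rw [show (g : ℝ) * q * ξ - g * p = g * (q * ξ - p) by ring, abs_mul,
        abs_of_nonneg (by positivity : (0 : ℝ) ≤ g)]
      ring
    rw [e]
    exact le_mul_of_one_le_left (by positivity) (by nlinarith)
  have hsm : (q : ℝ) * |q * ξ - p| * r ^ t < 1 :=
    (mul_le_mul_of_nonneg_right hred (by positivity)).trans_lt hmain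
  refine ⟨q, p, hq1, ?_, hcop, ?_⟩
  · by_contra! hlt
    have h1 := hlow q hq1 hlt p
    have h2 : ε ≤ q * |q * ξ - p| := h1.trans (le_mul_of_one_le_left (abs_nonneg _) hqR)
    have h3 : ε * r ^ t < 1 := (mul_le_mul_of_nonneg_right h2 (by positivity)).trans_lt hsm
    rw [div_lt_iff₀ hε] at hte
    linarith
  · have h0 : 0 ≤ (q : ℝ) * |q * ξ - p| := by positivity
    have := mul_le_mul_of_nonneg_right htH.le h0
    linarith

theorem stmt17 (r s : ℕ) (hr : 0 < r) (hs : 0 < s) (hind : MultIndep r s)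
    (ξ : ℝ) (hξ : Irrational ξ) :
    ¬ ((∀ n : ℕ, 1 ≤ n → wordComplexity (bdigit r ξ) n = n + 1) ∧
       (∀ n : ℕ, 1 ≤ n → wordComplexity (bdigit s ξ) n = n + 1)) := by
  rintro ⟨hSr, hSs⟩
  have hr2 : 2 ≤ r := by
    by_contra! h
    have : r = 1 := by omega
    subst this
    have := (hind 1 0 (by simp)).1
    omega
  have hs2 : 2 ≤ s := by
    by_contra! h
    have : s = 1 := by omega
    subst this
    have := (hind 0 1 (by simp)).2
    omega
  have hrr : ∀ n, 1 ≤ n → ∃ u v, 1 ≤ v ∧ u + v ≤ n + 1 ∧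
      ∀ i < n, bdigit r ξ (u + i) = bdigit r ξ (u + v + i) :=
    fun n hn => exists_rep _ n (hSr n hn)
  have hrs : ∀ n, 1 ≤ n → ∃ u v, 1 ≤ v ∧ u + v ≤ n + 1 ∧
      ∀ i < n, bdigit s ξ (u + i) = bdigit s ξ (u + v + i) :=
    fun n hn => exists_rep _ n (hSs n hn)
  have hN : ∀ A B : ℕ, ∃ M : ℕ, 1 ≤ A → 1 ≤ B → ∀ u v u' v' : ℕ, 1 ≤ v → 1 ≤ v' →
      A * (r ^ u * (r ^ v - 1)) = B * (s ^ u' * (s ^ v' - 1)) → u + v ≤ M := by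
    intro A B
    by_cases h : 1 ≤ A ∧ 1 ≤ B
    · obtain ⟨M, hM⟩ := bounded_solutions r s A B hr2 hs2 hind h.1 h.2
      exact ⟨M, fun _ _ => hM⟩
    · exact ⟨0, fun h1 h2 => absurd ⟨h1, h2⟩ h⟩
  choose Mf hMf using hN
  set K := 2 * r ^ 2 + 2 * s ^ 2 + 1 with hK
  set Ms := ∑ j ∈ Finset.range K, ∑ l ∈ Finset.range K, Mf j l with hMs
  have hMle : ∀ j l, j < K → l < K → Mf j l ≤ Ms := by
    intro j l hj hl
    calc Mf j l ≤ ∑ l ∈ Finset.range K, Mf j l :=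
          Finset.single_le_sum (f := fun l => Mf j l) (fun _ _ => Nat.zero_le _)
            (Finset.mem_range.2 hl)
      _ ≤ Ms := Finset.single_le_sum (f := fun j => ∑ l ∈ Finset.range K, Mf j l)
            (fun _ _ => Nat.zero_le _) (Finset.mem_range.2 hj)
  obtain ⟨q, p, hq1, hq0, hcop, hsmall⟩ :=
    good_approx r hr2 ξ hξ hrr (4 * (r : ℝ) ^ 2 + 4 * (s : ℝ) ^ 2) (r ^ Ms)
  have h0 : 0 ≤ (q : ℝ) * |q * ξ - p| := by positivity
  have m1 := mul_nonneg (by positivity : 0 ≤ 4 * (r : ℝ) ^ 2) h0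
  have m2 := mul_nonneg (by positivity : 0 ≤ 4 * (s : ℝ) ^ 2) h0
  obtain ⟨u, v, A, hv, hA1, hA, heA⟩ := matching r hr2 ξ
    (fun n hn => by
      obtain ⟨u, v, h1, h2, h3⟩ := hrr n hn
      exact ⟨u, v, h1, h2, bdigit_approx r hr2 ξ n u v h3⟩) q p hq1 hcop (by linarith)
  obtain ⟨u', v', B, hv', hB1, hB, heB⟩ := matching s hs2 ξ
    (fun n hn => by
      obtain ⟨u, v, h1, h2, h3⟩ := hrs n hn
      exact ⟨u, v, h1, h2, bdigit_approx s hs2 ξ n u v h3⟩) q p hq1 hcop (by linarith)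
  have hle := hMf B A hB1 hA1 u v u' v' hv hv' (by rw [heA, heB]; ring)
  have hle2 := hle.trans (hMle B A (by omega) (by omega))
  have h1 : q ≤ r ^ u * (r ^ v - 1) := by
    rw [heA]; exact Nat.le_mul_of_pos_left _ hA1
  have hrv : 2 ≤ r ^ v := hr2.trans (Nat.le_self_pow (by omega) r)
  have h2 : r ^ u * (r ^ v - 1) < r ^ (u + v) := by
    rw [pow_add]
    exact Nat.mul_lt_mul_of_pos_left (by omega) (by positivity)
  have h3 : r ^ (u + v) ≤ r ^ Ms := Nat.pow_le_pow_right (by omega) hle2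
  omega
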